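/- Let k ≥ 2, let F_k be the free group on free basis {a_1,…,a_k}, with word length |·| taken with respect to {a_1,…,a_k}^{±1} (i.e. the reduced-word length), and let ab : F_k → ℤ^k be the abelianization map. Let V_1 = {f ∈ F_k : gcd(ab(f)) = 1} be the set of visible elements. Then lim_{m→∞} #{f ∈ V_1 : |f| = 2m}/#{f ∈ F_k : |f| = 2m} = (2^k − 2)/((2^k − 1) ζ(k)) and lim_{m→∞} #{f ∈ V_1 : |f| = 2m−1}/#{f ∈ F_k : |f| = 2m−1} = 2^k/((2^k − 1) ζ(k)). -/

import Mathlib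

open Filter

/-- The Riemann zeta function at a natural number argument, ζ(k) = Σ_{m≥1} m^{-k}. -/
noncomputable def zetaR (r : ℕ) : ℝ := ∑' m : ℕ, 1 / ((m : ℝ) + 1) ^ r

/-- The abelianization map `F_k → ℤ^k` of the free group of rank `k`, sending the `i`-th
free generator to the `i`-th standard basis vector. -/
noncomputable def fgAb (k : ℕ) (f : FreeGroup (Fin k)) : Fin k → ℤ :=
  Multiplicative.toAdd
    ((FreeGroup.lift fun i => Multiplicative.ofAdd (Pi.single i (1 : ℤ))) f)

/-- The sphere of radius `n` about the identity of the free group of rank `k`. -/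
noncomputable def wordSphere (k n : ℕ) : Finset (FreeGroup (Fin k)) :=
  Set.Finite.toFinset (s := {f : FreeGroup (Fin k) | f.toWord.length = n})
    ((List.finite_length_eq (Fin k × Bool) n).preimage FreeGroup.toWord_injective.injOn)

theorem mem_wordSphere {k n : ℕ} {f : FreeGroup (Fin k)} :
    f ∈ wordSphere k n ↔ f.toWord.length = n := by
  simp [wordSphere]

theorem toWord_mk_singleton_mul {k : ℕ} (x : Fin k × Bool) (w : FreeGroup (Fin k)) :
    (FreeGroup.mk [x] * w).toWord = FreeGroup.reduce (x :: w.toWord) := by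
  conv_lhs => rw [← FreeGroup.mk_toWord (x := w)]
  rw [FreeGroup.mul_mk, FreeGroup.toWord_mk]
  rfl

/-- The number of letters whose product with `w` has length `n + 1`. -/
theorem card_filter_length_mul {k : ℕ} (w : FreeGroup (Fin k)) (n : ℕ)
    (hw : w.toWord.length = n + 2 ∨ w.toWord.length = n) :
    (Finset.univ.filter fun x : Fin k × Bool =>
      (FreeGroup.mk [x] * w).toWord.length = n + 1).card =
      if w.toWord.length = n + 2 then 1 else if n = 0 then 2 * k else 2 * k - 1 := by
  simp only [toWord_mk_singleton_mul, FreeGroup.reduce.cons, FreeGroup.reduce_toWord]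
  rcases hL : w.toWord with _ | ⟨h, t⟩
  · rw [hL] at hw
    have h0 : n = 0 := by simpa using (hw.resolve_left (by simp)).symm
    subst h0
    simp [mul_comm]
  · rw [hL] at hw
    have key : ∀ x : Fin k × Bool, (x.1 = h.1 ∧ x.2 = !h.2) ↔ x = (h.1, !h.2) := by
      intro x
      rw [Prod.ext_iff]
    simp only [key]
    by_cases h2 : (h :: t).length = n + 2
    · rw [if_pos h2, Finset.card_eq_one]
      refine ⟨(h.1, !h.2), ?_⟩
      ext x
      simp only [List.length_cons, Nat.add_right_cancel_iff] at h2
      by_cases hx : x = (h.1, !h.2)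
      · simp [hx, h2]
      · simp only [hx, if_false, Finset.mem_filter, Finset.mem_univ, true_and,
          List.length_cons, Finset.mem_singleton, iff_false]
        omega
    · have h3 := hw.resolve_left h2
      simp only [List.length_cons] at h3
      have hn : n ≠ 0 := by omega
      rw [if_neg h2, if_neg hn]
      have : (Finset.univ.filter fun x : Fin k × Bool =>
          (if x = (h.1, !h.2) then t else x :: h :: t).length = n + 1) =
          Finset.univ.erase (h.1, !h.2) := by
        ext x
        by_cases hx : x = (h.1, !h.2)
        · simp [hx]; omega
        · simp [hx, h3]
      rw [this, Finset.card_erase_of_mem (Finset.mem_univ _)]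
      simp [mul_comm]

theorem length_mul_of_mem {k n : ℕ} {f : FreeGroup (Fin k)} (x : Fin k × Bool)
    (hf : f.toWord.length = n + 1) :
    (FreeGroup.mk [x] * f).toWord.length = n + 2 ∨
      (FreeGroup.mk [x] * f).toWord.length = n := by
  rw [toWord_mk_singleton_mul, FreeGroup.reduce.cons, FreeGroup.reduce_toWord]
  rcases hL : f.toWord with _ | ⟨h, t⟩
  · simp [hL] at hf
  · rw [hL] at hf
    simp only [List.length_cons, Nat.add_right_cancel_iff] at hf
    simp only
    split_ifs <;> simp [hf]

theorem mk_flip_mul_mk_mul {k : ℕ} (x : Fin k × Bool) (f : FreeGroup (Fin k)) :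
    FreeGroup.mk [(x.1, !x.2)] * (FreeGroup.mk [x] * f) = f := by
  have : (FreeGroup.mk [(x.1, !x.2)] : FreeGroup (Fin k)) = (FreeGroup.mk [x])⁻¹ := by
    simp [FreeGroup.inv_mk, FreeGroup.invRev]
  rw [this, inv_mul_cancel_left]

/-- The Hecke relation for spheres in a free group. -/
theorem sum_wordSphere_sum_letters {k : ℕ} {R : Type*} [Semiring R] (n : ℕ)
    (φ : FreeGroup (Fin k) → R) :
    ∑ f ∈ wordSphere k (n + 1), ∑ x : Fin k × Bool, φ (FreeGroup.mk [x] * f) =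
      ∑ f ∈ wordSphere k (n + 2), φ f +
        ((if n = 0 then 2 * k else 2 * k - 1 : ℕ) : R) * ∑ f ∈ wordSphere k n, φ f := by
  classical
  have hdisj : Disjoint (wordSphere k (n + 2)) (wordSphere k n) := by
    rw [Finset.disjoint_left]
    intro f h1 h2
    rw [mem_wordSphere] at h1 h2
    omega
  have h1 : ∑ f ∈ wordSphere k (n + 1), ∑ x : Fin k × Bool, φ (FreeGroup.mk [x] * f) =
      ∑ w ∈ wordSphere k (n + 2) ∪ wordSphere k n,
        ∑ x ∈ Finset.univ.filter (fun x : Fin k × Bool =>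
          (FreeGroup.mk [x] * w).toWord.length = n + 1), φ w := by
    rw [Finset.sum_sigma', Finset.sum_sigma']
    refine Finset.sum_bij' (fun p _ => ⟨FreeGroup.mk [p.2] * p.1, (p.2.1, !p.2.2)⟩)
      (fun p _ => ⟨FreeGroup.mk [p.2] * p.1, (p.2.1, !p.2.2)⟩) ?_ ?_ ?_ ?_ ?_
    · rintro ⟨f, x⟩ h
      simp only [Finset.mem_sigma, Finset.mem_univ, and_true, mem_wordSphere] at h
      simp only [Finset.mem_sigma, Finset.mem_union, mem_wordSphere, Finset.mem_filter,
        Finset.mem_univ, true_and, mk_flip_mul_mk_mul]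
      exact ⟨length_mul_of_mem x h, h⟩
    · rintro ⟨f, x⟩ h
      simp only [Finset.mem_sigma, Finset.mem_union, mem_wordSphere, Finset.mem_filter,
        Finset.mem_univ, true_and] at h
      simp only [Finset.mem_sigma, Finset.mem_univ, and_true, mem_wordSphere]
      exact h.2
    · rintro ⟨f, x⟩ _
      simp [mk_flip_mul_mk_mul]
    · rintro ⟨f, x⟩ _
      simp [mk_flip_mul_mk_mul]
    · rintro ⟨f, x⟩ _
      rfl
  rw [h1, Finset.sum_union hdisj, Finset.mul_sum]
  congr 1
  · refine Finset.sum_congr rfl fun w hw => ?_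
    rw [mem_wordSphere] at hw
    rw [Finset.sum_const, card_filter_length_mul w n (Or.inl hw), if_pos hw, one_smul]
  · refine Finset.sum_congr rfl fun w hw => ?_
    rw [mem_wordSphere] at hw
    rw [Finset.sum_const, card_filter_length_mul w n (Or.inr hw), if_neg (by omega),
      nsmul_eq_mul]

theorem fgAb_mk_singleton_mul {k : ℕ} (x : Fin k × Bool) (f : FreeGroup (Fin k)) :
    fgAb k (FreeGroup.mk [x] * f) =
      fgAb k f + Pi.single x.1 (if x.2 then (1 : ℤ) else -1) := by
  obtain ⟨i, b⟩ := x
  have : fgAb k (FreeGroup.mk [(i, b)] * f) = fgAb k (FreeGroup.mk [(i, b)]) + fgAb k f := by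
    simp [fgAb]
  rw [this, add_comm]
  congr 1
  cases b <;> simp [fgAb, ← Pi.single_neg]

theorem wordSphere_zero (k : ℕ) : wordSphere k 0 = {1} := by
  ext f
  simp [mem_wordSphere]

theorem sum_wordSphere_one {k : ℕ} {R : Type*} [Semiring R] (φ : FreeGroup (Fin k) → R) :
    ∑ f ∈ wordSphere k 1, φ f = ∑ x : Fin k × Bool, φ (FreeGroup.mk [x]) := by
  symm
  refine Finset.sum_bij (fun x _ => FreeGroup.mk [x]) ?_ ?_ ?_ ?_
  · intro x _
    simp [mem_wordSphere, FreeGroup.toWord_mk]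
  · intro x _ y _ h
    have := congrArg FreeGroup.toWord h
    simpa [FreeGroup.toWord_mk] using this
  · intro f hf
    rw [mem_wordSphere, List.length_eq_one_iff] at hf
    obtain ⟨x, hx⟩ := hf
    exact ⟨x, Finset.mem_univ _, by rw [← hx, FreeGroup.mk_toWord]⟩
  · intro x _; rfl

/-- The sum of `ψ ∘ ab` over the sphere of radius `n`. -/
noncomputable def sphereSum {k : ℕ} {R : Type*} [Semiring R] (n : ℕ) (ψ : (Fin k → ℤ) → R) : R :=
  ∑ f ∈ wordSphere k n, ψ (fgAb k f)

/-- The sum of `ψ` over the nearest neighbours of `z` in `ℤ^k`. -/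
noncomputable def neighbourSum {k : ℕ} {R : Type*} [Semiring R] (ψ : (Fin k → ℤ) → R)
    (z : Fin k → ℤ) : R :=
  ∑ i, (ψ (z + Pi.single i 1) + ψ (z + Pi.single i (-1)))

theorem sphereSum_zero {k : ℕ} {R : Type*} [Semiring R] (ψ : (Fin k → ℤ) → R) :
    sphereSum 0 ψ = ψ 0 := by
  have : fgAb k 1 = 0 := by simp [fgAb]
  simp [sphereSum, wordSphere_zero, this]

theorem sphereSum_one {k : ℕ} {R : Type*} [Semiring R] (ψ : (Fin k → ℤ) → R) :
    sphereSum 1 ψ = neighbourSum ψ 0 := by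
  have h0 : fgAb k 1 = 0 := by simp [fgAb]
  have (x : Fin k × Bool) : fgAb k (FreeGroup.mk [x]) =
      Pi.single x.1 (if x.2 then (1 : ℤ) else -1) := by
    simpa [h0] using fgAb_mk_singleton_mul x 1
  rw [sphereSum, sum_wordSphere_one, neighbourSum]
  simp [this, Fintype.sum_prod_type]

theorem sphereSum_neighbourSum {k : ℕ} {R : Type*} [Semiring R] (n : ℕ)
    (ψ : (Fin k → ℤ) → R) :
    sphereSum (n + 1) (neighbourSum ψ) =
      sphereSum (n + 2) ψ +
        ((if n = 0 then 2 * k else 2 * k - 1 : ℕ) : R) * sphereSum n ψ := by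
  rw [sphereSum, sphereSum, sphereSum,
    ← sum_wordSphere_sum_letters n fun f => ψ (fgAb k f)]
  refine Finset.sum_congr rfl fun f _ => ?_
  simp [neighbourSum, fgAb_mk_singleton_mul, Fintype.sum_prod_type]

/-- The polynomials giving the eigenvalues of the sphere sums in terms of the eigenvalue `s` of the
neighbour sum on the `(q + 1)`-regular tree, with the value at `0` adjusted so that one recursion
holds throughout. -/
noncomputable def heckePoly (q s : ℝ) : ℕ → ℝ
  | 0 => (q + 1) / q
  | 1 => s
  | n + 2 => s * heckePoly q s (n + 1) - q * heckePoly q s n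

theorem sphereSum_eq_heckePoly {k : ℕ} (hk : 1 ≤ k) {R : Type*} [CommRing R] [Algebra ℝ R]
    (ψ : (Fin k → ℤ) → R) (s : ℝ) (h0 : ψ 0 = 1)
    (hs : ∀ z, neighbourSum ψ z = algebraMap ℝ R s * ψ z) (n : ℕ) :
    sphereSum (n + 1) ψ = algebraMap ℝ R (heckePoly (2 * k - 1) s (n + 1)) := by
  have hk' : (1 : ℝ) ≤ k := by exact_mod_cast hk
  have hmul (n : ℕ) :
      sphereSum n (neighbourSum ψ) = algebraMap ℝ R s * sphereSum n ψ := by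
    simp only [sphereSum, hs, Finset.mul_sum]
  have hrec (n : ℕ) := sphereSum_neighbourSum n ψ
  simp only [hmul] at hrec
  have h1 : sphereSum 1 ψ = algebraMap ℝ R s := by rw [sphereSum_one, hs, h0, mul_one]
  induction n using Nat.twoStepInduction with
  | zero => simpa [heckePoly] using h1
  | one =>
    have h := hrec 0
    rw [sphereSum_zero, h0, if_pos rfl, zero_add, zero_add, h1] at h
    have : heckePoly (2 * k - 1) s (1 + 1) = s * s - 2 * k := by
      simp only [heckePoly]
      rw [mul_div_cancel₀ _ (by linarith)]
      ring
    rw [this, map_sub, map_mul, h, map_mul, map_natCast, map_ofNat]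
    push_cast
    ring
  | more n ih1 ih2 =>
    have h := hrec (n + 1)
    rw [if_neg (by omega), ih1, ih2] at h
    have : heckePoly (2 * k - 1) s (n + 2 + 1) = s * heckePoly (2 * k - 1) s (n + 1 + 1) -
        (2 * k - 1) * heckePoly (2 * k - 1) s (n + 1) := by
      rw [heckePoly]
    rw [this, map_sub, map_mul, h, Nat.cast_sub (by omega), map_mul, map_sub, map_mul,
      map_natCast, map_ofNat, map_one]
    push_cast
    ring

theorem heckePoly_self {q : ℝ} (hq : q ≠ 0) (n : ℕ) :
    heckePoly q (q + 1) (n + 1) = (q + 1) * q ^ n := by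
  induction n using Nat.twoStepInduction with
  | zero => simp [heckePoly]
  | one =>
    simp only [heckePoly]
    field_simp
    ring
  | more n ih1 ih2 =>
    rw [heckePoly, ih1, ih2]
    ring

theorem heckePoly_neg (q s : ℝ) (n : ℕ) :
    heckePoly q (-s) n = (-1) ^ n * heckePoly q s n := by
  induction n using Nat.twoStepInduction with
  | zero => simp [heckePoly]
  | one => simp [heckePoly]
  | more n ih1 ih2 =>
    rw [heckePoly, ih1, ih2, heckePoly]
    ring

theorem card_wordSphere {k : ℕ} (hk : 1 ≤ k) (n : ℕ) :
    ((wordSphere k (n + 1)).card : ℝ) = 2 * k * (2 * k - 1) ^ n := by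
  have hk' : (1 : ℝ) ≤ k := by exact_mod_cast hk
  have h := sphereSum_eq_heckePoly hk (R := ℝ) (fun _ : Fin k → ℤ => 1) (2 * k - 1 + 1) rfl
    (by intro z; simp [neighbourSum]; ring) n
  rw [heckePoly_self (by linarith)] at h
  simpa [sphereSum] using h

theorem pow_le_card_wordSphere {k : ℕ} (hk : 1 ≤ k) (n : ℕ) :
    (2 * k - 1 : ℝ) ^ (n + 1) ≤ (wordSphere k (n + 1)).card := by
  have hk' : (1 : ℝ) ≤ k := by exact_mod_cast hk
  rw [card_wordSphere hk, pow_succ']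
  have : (0 : ℝ) ≤ (2 * k - 1) ^ n := pow_nonneg (by linarith) n
  nlinarith

theorem neighbourSum_sum_sq {k : ℕ} (z : Fin k → ℤ) :
    neighbourSum (fun z : Fin k → ℤ => ∑ i, (z i : ℝ) ^ 2) z =
      2 * k * ∑ i, (z i : ℝ) ^ 2 + 2 * k := by
  have key (i : Fin k) : (∑ j, (((z + Pi.single i 1 : Fin k → ℤ) j : ℤ) : ℝ) ^ 2) +
      ∑ j, (((z + Pi.single i (-1) : Fin k → ℤ) j : ℤ) : ℝ) ^ 2 = 2 * (∑ j, (z j : ℝ) ^ 2) + 2 := by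
    rw [← Finset.sum_add_distrib, Finset.mul_sum]
    have : ∑ j : Fin k, (if j = i then 2 else 0) = (2 : ℝ) := by simp
    conv_rhs => rw [← this, ← Finset.sum_add_distrib]
    refine Finset.sum_congr rfl fun j _ => ?_
    by_cases h : j = i
    · subst h; simp; ring
    · simp [h]; ring
  simp only [neighbourSum, key]
  simp
  ring

/-- The second moment of the abelianization grows at most linearly. -/
theorem sphereSum_sum_sq_le {k : ℕ} (hk : 2 ≤ k) (n : ℕ) :
    sphereSum n (fun z : Fin k → ℤ => ∑ i, (z i : ℝ) ^ 2) ≤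
      (2 * k) ^ 2 * n * (2 * k - 1) ^ n := by
  have hk' : (2 : ℝ) ≤ k := by exact_mod_cast hk
  set M : ℕ → ℝ := fun n => sphereSum n (fun z : Fin k → ℤ => ∑ i, (z i : ℝ) ^ 2) with hM
  have hM0 : M 0 = 0 := by simp [hM, sphereSum_zero]
  have hM1 : M 1 = 2 * k := by
    simp only [hM]
    rw [sphereSum_one, neighbourSum_sum_sq]
    simp
  have hrec (n : ℕ) : M (n + 2) = 2 * k * M (n + 1) + 2 * k * (2 * k * (2 * k - 1) ^ n) -
      (2 * k - 1) * M n := by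
    have h := sphereSum_neighbourSum n (fun z : Fin k → ℤ => ∑ i, (z i : ℝ) ^ 2)
    have h2 : sphereSum (n + 1) (neighbourSum fun z : Fin k → ℤ => ∑ i, (z i : ℝ) ^ 2) =
        2 * k * M (n + 1) + 2 * k * (2 * k * (2 * k - 1) ^ n) := by
      rw [← card_wordSphere (by omega)]
      simp only [sphereSum, neighbourSum_sum_sq, hM, Finset.sum_add_distrib, Finset.mul_sum]
      simp [mul_comm]
    rw [h2] at h
    rcases n with _ | n
    · have h0 : sphereSum 0 (fun z : Fin k → ℤ => ∑ i, (z i : ℝ) ^ 2) = 0 := hM0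
      rw [h0] at h
      rw [hM0]
      simp only [hM] at h ⊢
      linarith
    · rw [if_neg (by omega), Nat.cast_sub (by omega)] at h
      push_cast at h
      simp only [hM] at h ⊢
      linarith
  have hq : (3 : ℝ) ≤ 2 * k - 1 := by linarith
  generalize hqd : (2 * k - 1 : ℝ) = q at *
  have hkq : (2 * k : ℝ) = q + 1 := by linarith
  simp only [hkq] at *
  have hpos (n : ℕ) : (0 : ℝ) < q ^ n := by positivity
  have hd (n : ℕ) : M (n + 1) - M n ≤ (q + 1) ^ 2 * (n + 1) * q ^ n := by
    induction n with
    | zero => simp [hM0, hM1]; nlinarith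
    | succ n ih =>
      rw [hrec n]
      have := mul_le_mul_of_nonneg_left ih (by linarith : (0 : ℝ) ≤ q)
      have h2 : (q + 1) ^ 2 * q ^ n ≤ (q + 1) ^ 2 * q ^ (n + 1) := by
        have := le_mul_of_one_le_right (hpos n).le (by linarith : 1 ≤ q)
        rw [pow_succ q n]
        exact mul_le_mul_of_nonneg_left this (by positivity)
      push_cast
      have e : q * ((q + 1) ^ 2 * (n + 1) * q ^ n) = (q + 1) ^ 2 * (n + 1) * q ^ (n + 1) := by
        ring
      nlinarith
  show M n ≤ _
  induction n with
  | zero => simp [hM0]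
  | succ n ih =>
    have h1 := hd n
    have h2 : (q + 1) ^ 2 * q ^ n * (2 * n + 1) ≤ (q + 1) ^ 2 * q ^ n * ((n + 1) * q) := by
      have := hpos n
      gcongr
      have : (0 : ℝ) ≤ n := n.cast_nonneg
      nlinarith
    push_cast
    rw [pow_succ q]
    nlinarith

theorem exists_roots_of_nonneg {q s : ℝ} (hq : 3 ≤ q) (h0 : 0 ≤ s) (hs : s ≤ q + 1) :
    ∃ a b : ℂ, a + b = s ∧ a * b = q ∧ ‖b‖ ≤ ‖a‖ ∧
      (‖a‖ ≤ (q + 1) / 2 ∨ (‖a‖ ≤ s - 1 ∧ ‖b‖ ≤ 3 / 4 * ‖a‖)) := by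
  by_cases h : s ^ 2 ≤ 4 * q
  · have hsq : √(4 * q - s ^ 2) ^ 2 = 4 * q - s ^ 2 := Real.sq_sqrt (by linarith)
    have hn : ‖(⟨s / 2, √(4 * q - s ^ 2) / 2⟩ : ℂ)‖ ≤ (q + 1) / 2 := by
      refine abs_le_of_sq_le_sq' ?_ (by linarith) |>.2
      rw [Complex.sq_norm, Complex.normSq_mk]
      nlinarith
    refine ⟨⟨s / 2, √(4 * q - s ^ 2) / 2⟩, ⟨s / 2, -(√(4 * q - s ^ 2) / 2)⟩, ?_, ?_, ?_,
      Or.inl hn⟩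
    · apply Complex.ext <;> simp
    · apply Complex.ext <;> simp <;> nlinarith
    · refine le_of_eq ?_
      rw [← sq_eq_sq₀ (norm_nonneg _) (norm_nonneg _), Complex.sq_norm, Complex.sq_norm,
        Complex.normSq_mk, Complex.normSq_mk]
      ring
  · push Not at h
    have hsq : √(s ^ 2 - 4 * q) ^ 2 = s ^ 2 - 4 * q := Real.sq_sqrt (by linarith)
    set w := √(s ^ 2 - 4 * q)
    have hw : 0 ≤ w := Real.sqrt_nonneg _
    have hs2 : 2 ≤ s := by nlinarith
    have hws : w ≤ s - 2 := abs_le_of_sq_le_sq' (by nlinarith) (by linarith) |>.2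
    have hna : ‖(((s + w) / 2 : ℝ) : ℂ)‖ = (s + w) / 2 := by
      rw [Complex.norm_real, Real.norm_of_nonneg (by linarith)]
    have hnb : ‖(((s - w) / 2 : ℝ) : ℂ)‖ = (s - w) / 2 := by
      rw [Complex.norm_real, Real.norm_of_nonneg (by linarith)]
    refine ⟨((s + w) / 2 : ℝ), ((s - w) / 2 : ℝ), ?_, ?_, ?_, ?_⟩
    · rw [← Complex.ofReal_add]; congr 1; ring
    · rw [← Complex.ofReal_mul]; congr 1; nlinarith
    · rw [hna, hnb]; linarith
    · rw [hna, hnb]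
      by_cases h2 : (s + w) / 2 ≤ (q + 1) / 2
      · exact Or.inl h2
      · refine Or.inr ⟨by linarith, ?_⟩
        push Not at h2
        set a := (s + w) / 2
        have hab : a * ((s - w) / 2) = q := by
          simp only [a]; nlinarith
        have ha : 0 < a := by linarith
        refine le_of_mul_le_mul_left ?_ ha
        rw [hab]
        nlinarith [mul_nonneg (by linarith : (0 : ℝ) ≤ 3 * q - 1) (by linarith : (0 : ℝ) ≤ q - 3)]

theorem exists_roots {q s : ℝ} (hq : 3 ≤ q) (hs : |s| ≤ q + 1) :
    ∃ a b : ℂ, a + b = s ∧ a * b = q ∧ ‖b‖ ≤ ‖a‖ ∧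
      (‖a‖ ≤ (q + 1) / 2 ∨ (‖a‖ ≤ |s| - 1 ∧ ‖b‖ ≤ 3 / 4 * ‖a‖)) := by
  rcases le_total 0 s with h | h
  · rw [abs_of_nonneg h] at hs ⊢
    exact exists_roots_of_nonneg hq h hs
  · rw [abs_of_nonpos h] at hs ⊢
    obtain ⟨a, b, h1, h2, h3, h4⟩ := exists_roots_of_nonneg hq (neg_nonneg.2 h) hs
    refine ⟨-a, -b, ?_, by rw [neg_mul_neg, h2], by simpa using h3, by simpa using h4⟩
    rw [← neg_add, h1]
    simp

theorem abs_heckePoly_le {q s : ℝ} (hq : 3 ≤ q) (hs : |s| ≤ q + 1) (n : ℕ) :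
    |heckePoly q s n| ≤ 12 * (q + 1) * q ^ n *
      ((n + 1) * (2 / 3) ^ n + Real.exp (-(n * ((q + 1 - |s|) / q)))) := by
  obtain ⟨a, b, hab, hmul, hba, hor⟩ := exists_roots hq hs
  have hnm : ‖a‖ * ‖b‖ = q := by
    rw [← norm_mul, hmul, Complex.norm_real, Real.norm_of_nonneg (by linarith)]
  have ha1 : 1 ≤ ‖a‖ := by
    by_contra! h
    nlinarith [norm_nonneg b, norm_nonneg a]
  have haq : ‖a‖ ≤ q := by
    rcases hor with h | h <;> linarith
  have hD (n : ℕ) : (heckePoly q s (n + 1) : ℂ) - b * heckePoly q s n =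
      a ^ n * (s - b * ((q + 1) / q)) := by
    induction n with
    | zero => simp [heckePoly]
    | succ n ih =>
      rw [heckePoly, pow_succ', mul_assoc, ← ih]
      push_cast
      rw [← hab, ← hmul]
      ring
  have hD0 : ‖(s - b * ((q + 1) / q) : ℂ)‖ ≤ 3 * (q + 1) := by
    have h1 : ‖((q + 1) / q : ℂ)‖ ≤ 2 := by
      rw [← Complex.ofReal_one, ← Complex.ofReal_add, ← Complex.ofReal_div, Complex.norm_real,
        Real.norm_of_nonneg (by positivity), div_le_iff₀ (by linarith)]
      linarith
    calc _ ≤ ‖(s : ℂ)‖ + ‖b‖ * ‖((q + 1) / q : ℂ)‖ := by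
          rw [← norm_mul]; exact norm_sub_le _ _
      _ ≤ (q + 1) + q * 2 := by
          rw [Complex.norm_real, Real.norm_eq_abs]
          gcongr
          linarith
      _ ≤ _ := by linarith
  have hstep (n : ℕ) : |heckePoly q s (n + 1)| ≤
      ‖b‖ * |heckePoly q s n| + 3 * (q + 1) * ‖a‖ ^ n := by
    have : (heckePoly q s (n + 1) : ℂ) = b * heckePoly q s n +
      a ^ n * (s - b * ((q + 1) / q)) := by rw [← hD]; ring
    rw [← Real.norm_eq_abs, ← Complex.norm_real, this]
    refine (norm_add_le _ _).trans ?_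
    rw [norm_mul, norm_mul, norm_pow, Complex.norm_real, Real.norm_eq_abs, mul_comm (‖a‖ ^ n)]
    gcongr
  have hP0 : |heckePoly q s 0| ≤ 2 := by
    rw [heckePoly, abs_of_nonneg (by positivity), div_le_iff₀ (by linarith)]
    linarith
  have hK : 0 < q + 1 := by linarith
  have hexp : 0 ≤ Real.exp (-(n * ((q + 1 - |s|) / q))) := (Real.exp_pos _).le
  rcases hor with h | ⟨h, h'⟩
  · have key : |heckePoly q s n| ≤ 3 * (q + 1) * (n + 1) * ‖a‖ ^ n := by
      induction n with
      | zero => simp; linarith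
      | succ n ih =>
        have ih := ih (Real.exp_pos _).le
        have hp : 0 ≤ ‖a‖ ^ n := by positivity
        calc _ ≤ ‖b‖ * |heckePoly q s n| + 3 * (q + 1) * ‖a‖ ^ n := hstep n
          _ ≤ ‖a‖ * (3 * (q + 1) * (n + 1) * ‖a‖ ^ n) + 3 * (q + 1) * (‖a‖ ^ n * ‖a‖) := by
            gcongr
            nlinarith
          _ = _ := by push_cast; ring
    calc _ ≤ _ := key
      _ ≤ 3 * (q + 1) * (n + 1) * (q * (2 / 3)) ^ n := by
        gcongr
        linarith
      _ = 3 * (q + 1) * q ^ n * ((n + 1) * (2 / 3) ^ n) := by rw [mul_pow]; ring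
      _ ≤ _ := by
        gcongr
        · norm_num
        · linarith
  · have key : |heckePoly q s n| ≤ 12 * (q + 1) * ‖a‖ ^ n := by
      clear hexp
      induction n with
      | zero => simp; linarith
      | succ n ih =>
        have hp : 0 ≤ ‖a‖ ^ n := by positivity
        calc _ ≤ ‖b‖ * |heckePoly q s n| + 3 * (q + 1) * ‖a‖ ^ n := hstep n
          _ ≤ 3 / 4 * ‖a‖ * (12 * (q + 1) * ‖a‖ ^ n) + 3 * (q + 1) * (‖a‖ ^ n * ‖a‖) := by
            gcongr
            nlinarith
          _ = _ := by ring
    have haexp : ‖a‖ ≤ q * Real.exp (-((q + 1 - |s|) / q)) := by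
      have h1 := Real.add_one_le_exp (-((q + 1 - |s|) / q))
      have h2 : q * (-((q + 1 - |s|) / q) + 1) = |s| - 1 := by field_simp; ring
      calc _ ≤ |s| - 1 := h
        _ ≤ _ := by rw [← h2]; gcongr
    calc _ ≤ _ := key
      _ ≤ 12 * (q + 1) * (q * Real.exp (-((q + 1 - |s|) / q))) ^ n := by gcongr
      _ = 12 * (q + 1) * q ^ n * Real.exp (-(n * ((q + 1 - |s|) / q))) := by
        rw [mul_pow, ← Real.exp_nat_mul]; ring_nf
      _ ≤ _ := by
        gcongr
        have : (0 : ℝ) ≤ (n + 1) * (2 / 3) ^ n := by positivity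
        linarith

/-- The additive character of `ℤ^k` trivial on `dℤ^k` with frequency `j / d`. -/
noncomputable def modChar {k : ℕ} (d : ℕ) (j : Fin k → ℕ) (z : Fin k → ℤ) : ℂ :=
  Complex.exp (∑ i, 2 * Real.pi * Complex.I * (j i * z i / d))

/-- The eigenvalue of the neighbour sum at `modChar d j`. -/
noncomputable def modEigenvalue {k : ℕ} (d : ℕ) (j : Fin k → ℕ) : ℝ :=
  ∑ i, 2 * Real.cos (2 * Real.pi * (j i / d))

theorem modChar_add_single {k : ℕ} (d : ℕ) (j : Fin k → ℕ) (z : Fin k → ℤ) (i : Fin k) (c : ℤ) :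
    modChar d j (z + Pi.single i c) =
      Complex.exp (2 * Real.pi * Complex.I * (j i * c / d)) * modChar d j z := by
  rw [modChar, modChar, ← Complex.exp_add]
  congr 1
  have : 2 * Real.pi * Complex.I * (j i * c / d) =
      ∑ l : Fin k, if l = i then 2 * Real.pi * Complex.I * (j i * c / d) else 0 := by simp
  rw [this, ← Finset.sum_add_distrib]
  refine Finset.sum_congr rfl fun l _ => ?_
  by_cases h : l = i
  · subst h
    simp
    ring
  · simp [h]

theorem neighbourSum_modChar {k : ℕ} (d : ℕ) (j : Fin k → ℕ) (z : Fin k → ℤ) :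
    neighbourSum (modChar d j) z =
      algebraMap ℝ ℂ (modEigenvalue d j) * modChar d j z := by
  simp only [neighbourSum, modChar_add_single, modEigenvalue, ← add_mul, ← Finset.sum_mul]
  congr 1
  rw [map_sum]
  refine Finset.sum_congr rfl fun i _ => ?_
  simp only [Complex.coe_algebraMap]
  push_cast
  rw [Complex.two_cos]
  congr 1 <;> congr 1 <;> ring

theorem modChar_zero {k : ℕ} (d : ℕ) (j : Fin k → ℕ) : modChar d j 0 = 1 := by
  simp [modChar]

theorem sum_range_exp {d : ℕ} (hd : d ≠ 0) (z : ℤ) :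
    ∑ a ∈ Finset.range d, Complex.exp (2 * Real.pi * Complex.I * (a * z / d)) =
      if (d : ℤ) ∣ z then (d : ℂ) else 0 := by
  have hd' : (d : ℂ) ≠ 0 := by exact_mod_cast hd
  have hpi : (2 * Real.pi * Complex.I : ℂ) ≠ 0 := Complex.two_pi_I_ne_zero
  set w := Complex.exp (2 * Real.pi * Complex.I * (z / d)) with hw
  have hpow (a : ℕ) : Complex.exp (2 * Real.pi * Complex.I * (a * z / d)) = w ^ a := by
    rw [hw, ← Complex.exp_nat_mul]
    congr 1
    ring
  simp only [hpow]
  split_ifs with h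
  · obtain ⟨c, rfl⟩ := h
    have : w = 1 := by
      rw [hw, Complex.exp_eq_one_iff]
      refine ⟨c, ?_⟩
      push_cast
      field_simp
    simp [this]
  · have hne : w ≠ 1 := by
      intro h1
      rw [hw, Complex.exp_eq_one_iff] at h1
      obtain ⟨c, hc⟩ := h1
      apply h
      refine ⟨c, ?_⟩
      rw [mul_comm (c : ℂ)] at hc
      have := mul_left_cancel₀ hpi hc
      rw [div_eq_iff hd'] at this
      rw [mul_comm]
      exact_mod_cast this
    have hwd : w ^ d = 1 := by
      rw [← hpow, Complex.exp_eq_one_iff]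
      refine ⟨z, ?_⟩
      field_simp
    rw [geom_sum_eq hne, hwd, sub_self, zero_div]

theorem sum_modChar {k d : ℕ} (hd : d ≠ 0) (z : Fin k → ℤ) :
    ∑ j ∈ Fintype.piFinset (fun _ : Fin k => Finset.range d), modChar d j z =
      if ∀ i, (d : ℤ) ∣ z i then (d : ℂ) ^ k else 0 := by
  simp only [modChar, Complex.exp_sum]
  rw [← Finset.prod_univ_sum (fun _ : Fin k => Finset.range d)
    (fun i a => Complex.exp (2 * Real.pi * Complex.I * (a * z i / d)))]
  simp only [sum_range_exp hd]
  split_ifs with h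
  · simp [h]
  · push Not at h
    obtain ⟨i, hi⟩ := h
    exact Finset.prod_eq_zero (Finset.mem_univ i) (if_neg hi)

/-- The number of words of length `n` whose abelianization is divisible by `d`. -/
noncomputable def divCount (k n d : ℕ) : ℕ :=
  ((wordSphere k n).filter fun f => ∀ i, (d : ℤ) ∣ fgAb k f i).card

theorem divCount_eq {k d : ℕ} (hk : 1 ≤ k) (hd : d ≠ 0) (n : ℕ) :
    (d : ℝ) ^ k * divCount k (n + 1) d =
      ∑ j ∈ Fintype.piFinset (fun _ : Fin k => Finset.range d),
        heckePoly (2 * k - 1) (modEigenvalue d j) (n + 1) := by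
  have h : ((d : ℂ) ^ k * divCount k (n + 1) d : ℂ) =
      ∑ j ∈ Fintype.piFinset (fun _ : Fin k => Finset.range d),
        (heckePoly (2 * k - 1) (modEigenvalue d j) (n + 1) : ℂ) := by
    have h1 (j : Fin k → ℕ) := sphereSum_eq_heckePoly hk (modChar d j) (modEigenvalue d j)
      (modChar_zero d j) (neighbourSum_modChar d j) n
    simp only [Complex.coe_algebraMap] at h1
    simp only [← h1, sphereSum]
    rw [Finset.sum_comm]
    simp only [sum_modChar hd]
    rw [← Finset.sum_filter, Finset.sum_const, nsmul_eq_mul, mul_comm]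
    rfl
  exact_mod_cast h

theorem abs_modEigenvalue_le {k : ℕ} (d : ℕ) (j : Fin k → ℕ) :
    |modEigenvalue d j| ≤ 2 * k - 1 + 1 := by
  refine (Finset.abs_sum_le_sum_abs _ _).trans ?_
  refine (Finset.sum_le_card_nsmul _ _ 2 fun i _ => ?_).trans (by simp; linarith)
  rw [abs_mul, abs_two]
  linarith [Real.abs_cos_le_one (2 * Real.pi * (j i / d))]

theorem exp_neg_sq_le {x : ℝ} (hx : 0 ≤ x) : Real.exp (-x ^ 2) ≤ 2 * (1 / (1 + x) ^ 2) := by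
  rw [Real.exp_neg, mul_one_div, inv_le_comm₀ (Real.exp_pos _) (by positivity), inv_div]
  have := Real.add_one_le_exp (x ^ 2)
  nlinarith [sq_nonneg (x - 1)]

theorem sum_range_exp_neg_sq_le {σ : ℝ} (hσ : 0 < σ) (m : ℕ) :
    ∑ i ∈ Finset.range m, Real.exp (-(i / σ) ^ 2) ≤ 2 * (1 + σ) := by
  have h1 (m : ℕ) : ∑ i ∈ Finset.range (m + 1), 1 / (1 + i / σ) ^ 2 ≤
      1 + σ - σ ^ 2 / (σ + m) := by
    induction m with
    | zero =>
      simp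
      rw [pow_two, mul_self_div_self]
      linarith
    | succ m ih =>
      rw [Finset.sum_range_succ]
      have e : 1 / (1 + ((m + 1 : ℕ) : ℝ) / σ) ^ 2 = σ ^ 2 / (σ + (m + 1)) ^ 2 := by
        push_cast
        field_simp
      have e2 : σ ^ 2 / (σ + (m + 1)) ^ 2 ≤ σ ^ 2 / (σ + m) - σ ^ 2 / (σ + (m + 1)) := by
        have : σ ^ 2 / (σ + m) - σ ^ 2 / (σ + (m + 1)) =
            σ ^ 2 / ((σ + m) * (σ + (m + 1))) := by
          field_simp
          ring
        rw [this]
        gcongr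
        nlinarith [(m.cast_nonneg : (0 : ℝ) ≤ m)]
      rw [e]
      push_cast
      linarith
  have h2 : ∑ i ∈ Finset.range m, 1 / (1 + (i : ℝ) / σ) ^ 2 ≤ 1 + σ := by
    refine (Finset.sum_le_sum_of_subset_of_nonneg
      (Finset.range_mono (Nat.le_succ m)) fun _ _ _ => by positivity).trans ((h1 m).trans ?_)
    have : 0 ≤ σ ^ 2 / (σ + m) := by positivity
    linarith
  calc _ ≤ ∑ i ∈ Finset.range m, 2 * (1 / (1 + (i : ℝ) / σ) ^ 2) :=
        Finset.sum_le_sum fun i _ => exp_neg_sq_le (by positivity)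
    _ = 2 * ∑ i ∈ Finset.range m, 1 / (1 + (i : ℝ) / σ) ^ 2 := by rw [Finset.mul_sum]
    _ ≤ _ := by gcongr

theorem exp_neg_one_sub_cos_le {b y : ℝ} (hb : 0 ≤ b) (hy : |y| ≤ 1 / 2) :
    Real.exp (-(b * (1 - Real.cos (2 * Real.pi * y)))) ≤ Real.exp (-(8 * b * y ^ 2)) := by
  have hpi := Real.pi_pos
  have h := Real.cos_le_one_sub_mul_cos_sq (x := 2 * Real.pi * y) (by
    rw [abs_mul, abs_of_pos (by positivity)]
    nlinarith)
  have e : 2 / Real.pi ^ 2 * (2 * Real.pi * y) ^ 2 = 8 * y ^ 2 := by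
    field_simp
    ring
  rw [e] at h
  rw [show 8 * b * y ^ 2 = b * (8 * y ^ 2) by ring]
  gcongr
  linarith

theorem exp_neg_sq_antitone {σ x y : ℝ} (hσ : 0 < σ) (hx : 0 ≤ x) (hxy : x ≤ y) :
    Real.exp (-(y / σ) ^ 2) ≤ Real.exp (-(x / σ) ^ 2) := by
  gcongr

theorem sum_exp_neg_one_sub_cos_le {b : ℝ} (hb : 0 < b) {d : ℕ} (hd : d ≠ 0) :
    ∑ j ∈ Finset.range d, Real.exp (-(b * (1 - Real.cos (2 * Real.pi * (j / d))))) ≤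
      4 * (1 + d / √(8 * b)) := by
  have hd' : (0 : ℝ) < d := by exact_mod_cast Nat.pos_of_ne_zero hd
  set σ := (d : ℝ) / √(8 * b) with hσd
  have hσ : 0 < σ := by positivity
  have hF (x : ℝ) : 8 * b * (x / d) ^ 2 = (x / σ) ^ 2 := by
    have : √(8 * b) ^ 2 = 8 * b := Real.sq_sqrt (by positivity)
    rw [hσd, div_div_eq_mul_div, div_pow, div_pow, mul_pow, this]
    ring
  have hterm (j : ℕ) (hj : j < d) :
      Real.exp (-(b * (1 - Real.cos (2 * Real.pi * (j / d))))) ≤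
        Real.exp (-(j / σ) ^ 2) + Real.exp (-((d - 1 - j : ℕ) / σ) ^ 2) := by
    have hj' : (j : ℝ) + 1 ≤ d := by exact_mod_cast hj
    rcases le_total ((j : ℝ) / d) (1 / 2) with h | h
    · have := exp_neg_one_sub_cos_le hb.le (y := (j : ℝ) / d)
        (by rw [abs_of_nonneg (by positivity)]; exact h)
      rw [hF] at this
      linarith [Real.exp_pos (-((d - 1 - j : ℕ) / σ) ^ 2)]
    · have := exp_neg_one_sub_cos_le hb.le (y := ((d : ℝ) - j) / d) (by
        rw [abs_of_nonneg (div_nonneg (by linarith) hd'.le), sub_div, div_self hd'.ne']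
        linarith)
      have e : 2 * Real.pi * (((d : ℝ) - j) / d) = 2 * Real.pi - 2 * Real.pi * (j / d) := by
        field_simp
      rw [hF, e, Real.cos_two_pi_sub] at this
      have h2 : Real.exp (-(((d : ℝ) - j) / σ) ^ 2) ≤ Real.exp (-((d - 1 - j : ℕ) / σ) ^ 2) := by
        apply exp_neg_sq_antitone hσ (Nat.cast_nonneg _)
        rw [Nat.cast_sub (by omega), Nat.cast_sub (by omega)]
        push_cast
        linarith
      linarith [Real.exp_pos (-(j / σ) ^ 2)]
  calc _ ≤ ∑ j ∈ Finset.range d,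
        (Real.exp (-(j / σ) ^ 2) + Real.exp (-((d - 1 - j : ℕ) / σ) ^ 2)) :=
        Finset.sum_le_sum fun j hj => hterm j (Finset.mem_range.1 hj)
    _ = ∑ j ∈ Finset.range d, Real.exp (-(j / σ) ^ 2) +
        ∑ j ∈ Finset.range d, Real.exp (-(j / σ) ^ 2) := by
      rw [Finset.sum_add_distrib,
        Finset.sum_range_reflect (fun j : ℕ => Real.exp (-((j : ℝ) / σ) ^ 2))]
    _ ≤ _ := by
      have := sum_range_exp_neg_sq_le hσ d
      linarith

theorem sum_exp_neg_one_add_cos_le {b : ℝ} (hb : 0 < b) {d : ℕ} (hd : d ≠ 0) :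
    ∑ j ∈ Finset.range d, Real.exp (-(b * (1 + Real.cos (2 * Real.pi * (j / d))))) ≤
      4 * (1 + d / √(8 * b)) := by
  have hd' : (0 : ℝ) < d := by exact_mod_cast Nat.pos_of_ne_zero hd
  set σ := (d : ℝ) / √(8 * b) with hσd
  have hσ : 0 < σ := by positivity
  have hF (x : ℝ) : 8 * b * (x / d) ^ 2 = (x / σ) ^ 2 := by
    have : √(8 * b) ^ 2 = 8 * b := Real.sq_sqrt (by positivity)
    rw [hσd, div_div_eq_mul_div, div_pow, div_pow, mul_pow, this]
    ring
  have hterm (j : ℕ) (hj : j < d) :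
      Real.exp (-(b * (1 + Real.cos (2 * Real.pi * (j / d))))) ≤
        Real.exp (-(|(j : ℝ) - d / 2| / σ) ^ 2) := by
    have hj' : (j : ℝ) + 1 ≤ d := by exact_mod_cast hj
    have := exp_neg_one_sub_cos_le hb.le (y := ((j : ℝ) - d / 2) / d) (by
      rw [abs_div, abs_of_pos hd', div_le_iff₀ hd', abs_le]
      constructor <;> linarith [(j.cast_nonneg : (0 : ℝ) ≤ j)])
    have e : 2 * Real.pi * (((j : ℝ) - d / 2) / d) = 2 * Real.pi * (j / d) - Real.pi := by
      field_simp
    rw [hF, e, Real.cos_sub_pi, sub_neg_eq_add] at this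
    rwa [div_pow, sq_abs, ← div_pow]
  obtain ⟨r, hr⟩ : ∃ r, d = (d / 2 + 1) + r := Nat.exists_eq_add_of_le (by omega)
  have hm1 : ((d / 2 : ℕ) : ℝ) ≤ d / 2 := Nat.cast_div_le
  have hm2 : (d : ℝ) / 2 ≤ (d / 2 : ℕ) + 1 := by
    have : d ≤ 2 * (d / 2 + 1) := by omega
    have : (d : ℝ) ≤ 2 * ((d / 2 : ℕ) + 1) := by exact_mod_cast this
    linarith
  generalize d / 2 = m at *
  calc _ ≤ ∑ j ∈ Finset.range d, Real.exp (-(|(j : ℝ) - d / 2| / σ) ^ 2) :=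
        Finset.sum_le_sum fun j hj => hterm j (Finset.mem_range.1 hj)
    _ = ∑ j ∈ Finset.range (m + 1), Real.exp (-(|(j : ℝ) - d / 2| / σ) ^ 2) +
        ∑ j ∈ Finset.range r, Real.exp (-(|((m + 1 + j : ℕ) : ℝ) - d / 2| / σ) ^ 2) := by
      rw [← Finset.sum_range_add
        (fun j : ℕ => Real.exp (-(|(j : ℝ) - d / 2| / σ) ^ 2)) (m + 1) r, ← hr]
    _ ≤ ∑ j ∈ Finset.range (m + 1), Real.exp (-((m + 1 - 1 - j : ℕ) / σ) ^ 2) +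
        ∑ j ∈ Finset.range r, Real.exp (-(j / σ) ^ 2) := by
      refine add_le_add (Finset.sum_le_sum fun j hj => ?_) (Finset.sum_le_sum fun j _ => ?_)
      · apply exp_neg_sq_antitone hσ (Nat.cast_nonneg _)
        have : j ≤ m := by
          have := Finset.mem_range.1 hj
          omega
        rw [Nat.add_sub_cancel, Nat.cast_sub this, abs_sub_comm]
        exact le_trans (by linarith) (le_abs_self _)
      · apply exp_neg_sq_antitone hσ (Nat.cast_nonneg _)
        refine le_trans ?_ (le_abs_self _)
        push_cast
        linarith
    _ ≤ _ := by
      rw [Finset.sum_range_reflect (fun j : ℕ => Real.exp (-((j : ℝ) / σ) ^ 2))]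
      have h1 := sum_range_exp_neg_sq_le hσ (m + 1)
      have h2 := sum_range_exp_neg_sq_le hσ r
      linarith

theorem div_pow_le_of_le_add {G x y : ℝ} {d k : ℕ} (hk : 2 ≤ k) (h0 : 0 ≤ G) (hd : 0 < d)
    (hGd : G ≤ d) (hG : G ≤ d * (x + y)) : G ^ k / (d : ℝ) ^ k ≤ 2 * (x ^ 2 + y ^ 2) := by
  have hd' : (0 : ℝ) < d := by exact_mod_cast hd
  rw [← div_pow]
  have h1 : G / d ≤ 1 := (div_le_one hd').2 hGd
  have h2 : G / d ≤ x + y := (div_le_iff₀' hd').2 hG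
  have h3 : 0 ≤ G / d := by positivity
  calc (G / d) ^ k ≤ (G / d) ^ 2 := pow_le_pow_of_le_one h3 h1 hk
    _ ≤ (x + y) ^ 2 := by gcongr
    _ ≤ _ := by nlinarith [sq_nonneg (x - y)]

theorem sum_exp_neg_modEigenvalue_le {k d n : ℕ} (hk : 2 ≤ k) (hd : d ≠ 0) (hn : n ≠ 0) :
    (∑ j ∈ Fintype.piFinset (fun _ : Fin k => Finset.range d),
      Real.exp (-(n * ((2 * k - 1 + 1 - |modEigenvalue d j|) / (2 * k - 1))))) / (d : ℝ) ^ k ≤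
      64 / (d : ℝ) ^ 2 + 8 * k / n := by
  have hk' : (2 : ℝ) ≤ k := by exact_mod_cast hk
  have hd' : (0 : ℝ) < d := by exact_mod_cast Nat.pos_of_ne_zero hd
  have hn' : (0 : ℝ) < n := by exact_mod_cast Nat.pos_of_ne_zero hn
  set q : ℝ := 2 * k - 1 with hq
  have hq0 : 0 < q := by linarith
  set b : ℝ := 2 * n / q with hb
  have hb0 : 0 < b := by positivity
  have hsplit (j : Fin k → ℕ) :
      Real.exp (-(n * ((q + 1 - |modEigenvalue d j|) / q))) ≤
        ∏ i, Real.exp (-(b * (1 - Real.cos (2 * Real.pi * (j i / d))))) +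
        ∏ i, Real.exp (-(b * (1 + Real.cos (2 * Real.pi * (j i / d))))) := by
    have h1 : ∏ i, Real.exp (-(b * (1 - Real.cos (2 * Real.pi * (j i / d))))) =
        Real.exp (-(n * ((q + 1 - modEigenvalue d j) / q))) := by
      rw [← Real.exp_sum]
      congr 1
      rw [Finset.sum_neg_distrib, ← Finset.mul_sum, Finset.sum_sub_distrib, modEigenvalue,
        ← Finset.mul_sum, hb]
      simp
      field_simp
      rw [hq]
      ring
    have h2 : ∏ i, Real.exp (-(b * (1 + Real.cos (2 * Real.pi * (j i / d))))) =
        Real.exp (-(n * ((q + 1 + modEigenvalue d j) / q))) := by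
      rw [← Real.exp_sum]
      congr 1
      rw [Finset.sum_neg_distrib, ← Finset.mul_sum, Finset.sum_add_distrib, modEigenvalue,
        ← Finset.mul_sum, hb]
      simp
      field_simp
      rw [hq]
      ring
    rw [h1, h2]
    rcases abs_cases (modEigenvalue d j) with ⟨h, _⟩ | ⟨h, _⟩ <;> rw [h]
    · linarith [Real.exp_pos (-(n * ((q + 1 + modEigenvalue d j) / q)))]
    · rw [sub_neg_eq_add]
      linarith [Real.exp_pos (-(n * ((q + 1 - modEigenvalue d j) / q)))]
  have hx : (4 / d : ℝ) ^ 2 = 16 / d ^ 2 := by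
    rw [div_pow]
    norm_num
  have hy : (4 / √(8 * b)) ^ 2 ≤ 2 * k / n := by
    rw [div_pow, Real.sq_sqrt (by positivity), hb, div_le_div_iff₀ (by positivity) hn']
    have : 2 * (k : ℝ) * (8 * (2 * n / q)) * q = 32 * k * n := by
      field_simp
      ring
    rw [← mul_le_mul_iff_left₀ hq0, this]
    nlinarith
  have hdist : 4 * (1 + d / √(8 * b)) = d * (4 / d + 4 / √(8 * b)) := by
    field_simp
  have hone (f : ℕ → ℝ) (hf : ∀ j, 0 ≤ f j) : ∑ j ∈ Finset.range d, Real.exp (-(b * f j)) ≤ d := by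
    refine (Finset.sum_le_card_nsmul _ _ 1 fun j _ => ?_).trans (by simp)
    rw [Real.exp_le_one_iff, neg_nonpos]
    exact mul_nonneg hb0.le (hf j)
  have hm := div_pow_le_of_le_add hk (Finset.sum_nonneg fun _ _ => (Real.exp_pos _).le)
    (Nat.pos_of_ne_zero hd)
    (hone (fun j => 1 - Real.cos (2 * Real.pi * (j / d))) fun j => by
      linarith [Real.cos_le_one (2 * Real.pi * (j / d))])
    ((sum_exp_neg_one_sub_cos_le hb0 hd).trans hdist.le)
  have hp := div_pow_le_of_le_add hk (Finset.sum_nonneg fun _ _ => (Real.exp_pos _).le)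
    (Nat.pos_of_ne_zero hd)
    (hone (fun j => 1 + Real.cos (2 * Real.pi * (j / d))) fun j => by
      linarith [Real.neg_one_le_cos (2 * Real.pi * (j / d))])
    ((sum_exp_neg_one_add_cos_le hb0 hd).trans hdist.le)
  have hprod (F : ℕ → ℝ) : ∑ j ∈ Fintype.piFinset (fun _ : Fin k => Finset.range d), ∏ i, F (j i) =
      (∑ a ∈ Finset.range d, F a) ^ k := by
    rw [← Finset.prod_univ_sum (fun _ : Fin k => Finset.range d) (fun _ a => F a)]
    simp
  calc _ ≤ (∑ j ∈ Fintype.piFinset (fun _ : Fin k => Finset.range d),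
        (∏ i, Real.exp (-(b * (1 - Real.cos (2 * Real.pi * (j i / d))))) +
          ∏ i, Real.exp (-(b * (1 + Real.cos (2 * Real.pi * (j i / d))))))) / (d : ℝ) ^ k := by
        gcongr with j
        exact hsplit j
    _ = (∑ a ∈ Finset.range d, Real.exp (-(b * (1 - Real.cos (2 * Real.pi * (a / d)))))) ^ k /
          (d : ℝ) ^ k +
        (∑ a ∈ Finset.range d, Real.exp (-(b * (1 + Real.cos (2 * Real.pi * (a / d)))))) ^ k /
          (d : ℝ) ^ k := by
      rw [Finset.sum_add_distrib, add_div,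
        hprod (fun a => Real.exp (-(b * (1 - Real.cos (2 * Real.pi * (a / d)))))),
        hprod (fun a => Real.exp (-(b * (1 + Real.cos (2 * Real.pi * (a / d))))))]
    _ ≤ 2 * ((4 / d) ^ 2 + (4 / √(8 * b)) ^ 2) + 2 * ((4 / d) ^ 2 + (4 / √(8 * b)) ^ 2) :=
      add_le_add hm hp
    _ ≤ 4 * (16 / d ^ 2 + 2 * k / n) := by rw [hx]; linarith
    _ = _ := by ring

theorem exists_mul_geometric_le :
    ∃ C : ℝ, 0 < C ∧ ∀ n : ℕ, n ≠ 0 → ((n : ℝ) + 1) * (2 / 3) ^ n ≤ C / n := by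
  have h := (tendsto_pow_const_mul_const_pow_of_abs_lt_one 2
    (r := (2 / 3 : ℝ)) (by rw [abs_of_pos] <;> norm_num)).bddAbove_range
  obtain ⟨C, hC⟩ := h
  have hC' (n : ℕ) : (n : ℝ) ^ 2 * (2 / 3) ^ n ≤ C := hC ⟨n, rfl⟩
  refine ⟨2 * C + 1, by linarith [(by simpa using hC' 0 : (0 : ℝ) ≤ C)], fun n hn => ?_⟩
  have hn' : (1 : ℝ) ≤ n := by exact_mod_cast Nat.one_le_iff_ne_zero.2 hn
  rw [le_div_iff₀ (by linarith)]
  have hp : (0 : ℝ) < (2 / 3) ^ n := by positivity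
  have h1 : ((n : ℝ) + 1) * n ≤ 2 * n ^ 2 := by nlinarith
  nlinarith [hC' n, mul_le_mul_of_nonneg_right h1 hp.le]

theorem abs_heckePoly_div_card_le {k : ℕ} (hk : 2 ≤ k) {s : ℝ} (hs : |s| ≤ 2 * k - 1 + 1)
    (n : ℕ) :
    |heckePoly (2 * k - 1) s (n + 1) / (wordSphere k (n + 1)).card| ≤
      24 * k * (((n + 1 : ℕ) + 1) * (2 / 3) ^ (n + 1) +
        Real.exp (-((n + 1 : ℕ) * ((2 * k - 1 + 1 - |s|) / (2 * k - 1))))) := by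
  have hk' : (2 : ℝ) ≤ k := by exact_mod_cast hk
  have hN := pow_le_card_wordSphere (k := k) (by omega) n
  have hq : (0 : ℝ) < (2 * k - 1) ^ (n + 1) := pow_pos (by linarith) _
  rw [abs_div, Nat.abs_cast, div_le_iff₀ (by linarith)]
  refine (abs_heckePoly_le (by linarith) hs (n + 1)).trans ?_
  set E := ((n + 1 : ℕ) + 1) * (2 / 3) ^ (n + 1) +
        Real.exp (-((n + 1 : ℕ) * ((2 * k - 1 + 1 - |s|) / (2 * k - 1))))
  have hE : 0 ≤ E := by positivity
  calc _ = 24 * k * E * (2 * k - 1) ^ (n + 1) := by ring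
    _ ≤ _ := by gcongr

/-- Uniform bound for the proportion of words whose abelianization is divisible by `d`. -/
theorem exists_divCount_le {k : ℕ} (hk : 2 ≤ k) : ∃ C : ℝ, 0 < C ∧ ∀ n d : ℕ, d ≠ 0 →
    (divCount k (n + 1) d : ℝ) / (wordSphere k (n + 1)).card ≤
      C * (1 / (d : ℝ) ^ 2 + 1 / (n + 1)) := by
  obtain ⟨C, hC, hgeo⟩ := exists_mul_geometric_le
  have hk' : (2 : ℝ) ≤ k := by exact_mod_cast hk
  refine ⟨24 * k * (C + 64 + 8 * k), by positivity, fun n d hd => ?_⟩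
  have hd' : (0 : ℝ) < d := by exact_mod_cast Nat.pos_of_ne_zero hd
  have hdk : (0 : ℝ) < (d : ℝ) ^ k := by positivity
  have heq := divCount_eq (k := k) (by omega) hd n
  set N : ℝ := ((wordSphere k (n + 1)).card : ℝ)
  set J := Fintype.piFinset (fun _ : Fin k => Finset.range d) with hJ
  have hcard : (J.card : ℝ) = (d : ℝ) ^ k := by simp [hJ]
  have hsum := sum_exp_neg_modEigenvalue_le hk hd (Nat.succ_ne_zero n)
  rw [← hJ] at hsum
  calc (divCount k (n + 1) d : ℝ) / N =
        (∑ j ∈ J, heckePoly (2 * k - 1) (modEigenvalue d j) (n + 1) / N) / (d : ℝ) ^ k := by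
        rw [← Finset.sum_div, ← heq]
        field_simp
    _ ≤ (∑ j ∈ J, 24 * k * (((n + 1 : ℕ) + 1) * (2 / 3) ^ (n + 1) +
        Real.exp (-((n + 1 : ℕ) * ((2 * k - 1 + 1 - |modEigenvalue d j|) / (2 * k - 1)))))) /
          (d : ℝ) ^ k := by
      gcongr with j
      exact (le_abs_self _).trans (abs_heckePoly_div_card_le hk (abs_modEigenvalue_le d j) n)
    _ = 24 * k * (((n + 1 : ℕ) + 1) * (2 / 3) ^ (n + 1) + (∑ j ∈ J,
        Real.exp (-((n + 1 : ℕ) * ((2 * k - 1 + 1 - |modEigenvalue d j|) / (2 * k - 1))))) /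
          (d : ℝ) ^ k) := by
      rw [← Finset.mul_sum, Finset.sum_add_distrib, Finset.sum_const, nsmul_eq_mul, hcard]
      field_simp
    _ ≤ 24 * k * (C / (n + 1 : ℕ) + (64 / (d : ℝ) ^ 2 + 8 * k / (n + 1 : ℕ))) := by
      gcongr
      exact hgeo (n + 1) (Nat.succ_ne_zero n)
    _ ≤ _ := by
      have h1 : 0 ≤ 1 / (d : ℝ) ^ 2 := by positivity
      have h2 : 0 ≤ 1 / ((n : ℝ) + 1) := by positivity
      rw [mul_assoc (24 * (k : ℝ))]
      gcongr
      push_cast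
      rw [div_eq_mul_one_div C, div_eq_mul_one_div 64, div_eq_mul_one_div (8 * (k : ℝ))]
      nlinarith [mul_nonneg hC.le h1, mul_nonneg (by linarith : (0 : ℝ) ≤ k) h1]

theorem tendsto_heckePoly_div_card {k : ℕ} (hk : 2 ≤ k) {s : ℝ} (hs : |s| < 2 * k - 1 + 1) :
    Tendsto (fun n : ℕ => heckePoly (2 * k - 1) s (n + 1) / (wordSphere k (n + 1)).card)
      atTop (nhds 0) := by
  have hk' : (2 : ℝ) ≤ k := by exact_mod_cast hk
  refine squeeze_zero_norm (abs_heckePoly_div_card_le hk hs.le) ?_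
  have hc : 0 < (2 * k - 1 + 1 - |s|) / (2 * k - 1) := div_pos (by linarith) (by linarith)
  have h1 : Tendsto (fun n : ℕ => ((n : ℝ) + 1) * (2 / 3) ^ n) atTop (nhds 0) := by
    have ha := tendsto_pow_const_mul_const_pow_of_abs_lt_one 1
      (r := (2 / 3 : ℝ)) (by rw [abs_of_pos] <;> norm_num)
    have hb := tendsto_pow_const_mul_const_pow_of_abs_lt_one 0
      (r := (2 / 3 : ℝ)) (by rw [abs_of_pos] <;> norm_num)
    simpa [add_mul] using ha.add hb
  have h2 : Tendsto (fun n : ℕ => Real.exp (-(n * ((2 * k - 1 + 1 - |s|) / (2 * k - 1)))))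
      atTop (nhds 0) :=
    Real.tendsto_exp_neg_atTop_nhds_zero.comp
      (tendsto_natCast_atTop_atTop.atTop_mul_const hc)
  simpa using (((h1.add h2).comp (tendsto_add_atTop_nat 1)).const_mul (24 * (k : ℝ)))

theorem cos_eq_one_of_nat_div {d a : ℕ} (ha : a < d)
    (h : Real.cos (2 * Real.pi * (a / d)) = 1) : a = 0 := by
  have hd : (0 : ℝ) < d := by exact_mod_cast (by omega : 0 < d)
  obtain ⟨n, hn⟩ := (Real.cos_eq_one_iff _).1 h
  have hpi := Real.pi_pos
  have h1 : (n : ℝ) * d = a := by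
    field_simp at hn
    linarith
  have h2 : n * d = a := by exact_mod_cast h1
  by_contra h0
  have hn0 : 0 < n := by
    by_contra! hle
    have : n * (d : ℤ) ≤ 0 := mul_nonpos_of_nonpos_of_nonneg hle (by positivity)
    omega
  nlinarith

theorem cos_eq_neg_one_of_nat_div {d a : ℕ} (ha : a < d)
    (h : Real.cos (2 * Real.pi * (a / d)) = -1) : d = 2 * a := by
  have hd : (0 : ℝ) < d := by exact_mod_cast (by omega : 0 < d)
  obtain ⟨n, hn⟩ := Real.cos_eq_neg_one_iff.1 h
  have hpi := Real.pi_pos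
  have h1 : (1 + 2 * n : ℝ) * d = 2 * a := by
    field_simp at hn
    linarith
  have h2 : (1 + 2 * n) * d = 2 * a := by exact_mod_cast h1
  have hn0 : n = 0 := by
    have : 0 ≤ n := by
      by_contra! hlt
      nlinarith
    have : n < 1 := by
      by_contra! hle
      nlinarith
    omega
  subst hn0
  omega

theorem modEigenvalue_eq_top {k d : ℕ} {j : Fin k → ℕ} (hj : ∀ i, j i < d)
    (h : modEigenvalue d j = 2 * k - 1 + 1) : j = 0 := by
  have h0 : ∑ i, (2 - 2 * Real.cos (2 * Real.pi * (j i / d))) = 0 := by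
    rw [Finset.sum_sub_distrib]
    rw [modEigenvalue] at h
    rw [h]
    simp
    ring
  rw [Finset.sum_eq_zero_iff_of_nonneg fun i _ => by
    linarith [Real.cos_le_one (2 * Real.pi * (j i / d))]] at h0
  ext i
  exact cos_eq_one_of_nat_div (hj i) (by linarith [h0 i (Finset.mem_univ i)])

theorem modEigenvalue_eq_bot {k d : ℕ} {j : Fin k → ℕ} (hj : ∀ i, j i < d)
    (h : modEigenvalue d j = -(2 * k - 1 + 1)) (i : Fin k) : d = 2 * j i := by
  have h0 : ∑ i, (2 + 2 * Real.cos (2 * Real.pi * (j i / d))) = 0 := by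
    rw [Finset.sum_add_distrib]
    rw [modEigenvalue] at h
    rw [h]
    simp
    ring
  rw [Finset.sum_eq_zero_iff_of_nonneg fun i _ => by
    linarith [Real.neg_one_le_cos (2 * Real.pi * (j i / d))]] at h0
  exact cos_eq_neg_one_of_nat_div (hj i) (by linarith [h0 i (Finset.mem_univ i)])

/-- Equidistribution modulo `d`, up to the parity constraint. -/
theorem tendsto_divCount {k : ℕ} (hk : 2 ≤ k) {d : ℕ} (hd : d ≠ 0) :
    Tendsto (fun n : ℕ => (divCount k (n + 1) d : ℝ) / (wordSphere k (n + 1)).card -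
      (1 + if 2 ∣ d then (-1) ^ (n + 1) else 0) / (d : ℝ) ^ k) atTop (nhds 0) := by
  have hk' : (2 : ℝ) ≤ k := by exact_mod_cast hk
  have hd' : (0 : ℝ) < d := by exact_mod_cast Nat.pos_of_ne_zero hd
  have hdk : (0 : ℝ) < (d : ℝ) ^ k := by positivity
  set J := Fintype.piFinset (fun _ : Fin k => Finset.range d) with hJ
  have hN (n : ℕ) : (0 : ℝ) < (wordSphere k (n + 1)).card :=
    (pow_pos (by linarith) _).trans_le (pow_le_card_wordSphere (by omega) n)
  have hself (n : ℕ) : heckePoly (2 * k - 1) (2 * k - 1 + 1) (n + 1) =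
      (wordSphere k (n + 1)).card := by
    rw [heckePoly_self (by linarith), card_wordSphere (by omega)]
    ring
  have hterm : ∀ j ∈ J, Tendsto (fun n : ℕ =>
      heckePoly (2 * k - 1) (modEigenvalue d j) (n + 1) / (wordSphere k (n + 1)).card -
        ((if j = 0 then 1 else 0) +
          if 2 ∣ d ∧ j = fun _ => d / 2 then (-1) ^ (n + 1) else 0)) atTop (nhds 0) := by
    intro j hj
    have hj' : ∀ i, j i < d := by simpa [hJ] using hj
    by_cases h0 : j = 0
    · have hne : ¬ (2 ∣ d ∧ j = fun _ => d / 2) := by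
        rintro ⟨h2, h3⟩
        have := congrFun h3 ⟨0, by omega⟩
        rw [h0] at this
        simp only [Pi.zero_apply] at this
        omega
      have hs : modEigenvalue d j = 2 * k - 1 + 1 := by
        simp [modEigenvalue, h0]
        ring
      simp only [if_pos h0, if_neg hne, hs, hself, div_self (hN _).ne']
      simp
    · by_cases h2 : 2 ∣ d ∧ j = fun _ => d / 2
      · have hs : modEigenvalue d j = -(2 * k - 1 + 1) := by
          obtain ⟨⟨c, rfl⟩, h3⟩ := h2
          have hc : (c : ℝ) ≠ 0 := by
            intro h
            simp [h] at hd'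
          have e : 2 * Real.pi * ((c : ℝ) / ((2 * c : ℕ) : ℝ)) = Real.pi := by
            push_cast
            field_simp
          have hcc : 2 * c / 2 = c := by omega
          simp only [modEigenvalue, h3, hcc, e, Real.cos_pi]
          simp
          ring
        simp only [if_neg h0, if_pos h2, hs, heckePoly_neg, hself, mul_div_assoc,
          div_self (hN _).ne']
        simp
      · simp only [if_neg h0, if_neg h2]
        simp only [add_zero, sub_zero]
        refine tendsto_heckePoly_div_card hk (lt_of_le_of_ne (abs_modEigenvalue_le d j) ?_)
        intro habs
        rcases abs_cases (modEigenvalue d j) with ⟨h, _⟩ | ⟨h, _⟩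
        · exact h0 (modEigenvalue_eq_top hj' (by rw [← h, habs]))
        · have h3 := modEigenvalue_eq_bot hj' (by rw [← habs, h, neg_neg])
          refine h2 ⟨⟨_, h3 ⟨0, by omega⟩⟩, funext fun i => ?_⟩
          have := h3 i
          omega
  have hlim := (tendsto_finsetSum J hterm).div_const ((d : ℝ) ^ k)
  rw [Finset.sum_const_zero, zero_div] at hlim
  refine hlim.congr fun n => ?_
  have hs1 : ∑ j ∈ J, (if j = 0 then 1 else 0 : ℝ) = 1 := by
    rw [Finset.sum_ite_eq' J 0 fun _ => (1 : ℝ), if_pos]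
    simpa [hJ] using fun _ => Nat.pos_of_ne_zero hd
  have hs2 : ∑ j ∈ J, (if 2 ∣ d ∧ j = fun _ => d / 2 then (-1) ^ (n + 1) else 0 : ℝ) =
      if 2 ∣ d then (-1) ^ (n + 1) else 0 := by
    by_cases h2 : 2 ∣ d
    · simp only [h2, true_and, if_true]
      rw [Finset.sum_ite_eq' J (fun _ => d / 2) fun _ => ((-1) ^ (n + 1) : ℝ), if_pos]
      simp only [hJ, Fintype.mem_piFinset, Finset.mem_range]
      intro _
      omega
    · simp [h2]
  rw [Finset.sum_sub_distrib, Finset.sum_add_distrib, hs1, hs2, ← Finset.sum_div,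
    ← divCount_eq (by omega) hd]
  field_simp

theorem abs_moebius_real_le_one (d : ℕ) : |(ArithmeticFunction.moebius d : ℝ)| ≤ 1 := by
  have h := ArithmeticFunction.abs_moebius_le_one (n := d)
  exact_mod_cast h

theorem summable_moebius_div {k : ℕ} (hk : 2 ≤ k) :
    Summable fun d : ℕ => (ArithmeticFunction.moebius d : ℝ) / (d : ℝ) ^ k := by
  refine Summable.of_norm_bounded (Real.summable_one_div_nat_pow.2 (by omega : 1 < k)) fun d => ?_
  rw [norm_div, Real.norm_eq_abs, norm_pow, Real.norm_natCast]
  gcongr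
  exact abs_moebius_real_le_one d

theorem zetaR_mul_tsum_moebius {k : ℕ} (hk : 2 ≤ k) :
    zetaR k * ∑' d : ℕ, (ArithmeticFunction.moebius d : ℝ) / (d : ℝ) ^ k = 1 := by
  have hs : 1 < (k : ℂ).re := by simpa using (by omega : 1 < k)
  have h := ArithmeticFunction.LSeries_zeta_mul_Lseries_moebius hs
  have hz : (zetaR k : ℂ) = riemannZeta k := by
    have hsum := Real.summable_one_div_nat_pow.2 (by omega : 1 < k)
    have : zetaR k = ∑' n : ℕ, 1 / (n : ℝ) ^ k := by
      rw [hsum.tsum_eq_zero_add, zetaR]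
      simp [show k ≠ 0 by omega]
    rw [this, zeta_nat_eq_tsum_of_gt_one (by omega)]
    push_cast
    rfl
  rw [ArithmeticFunction.LSeries_zeta_eq_riemannZeta hs, ← hz] at h
  have hL : LSeries (fun n => ((ArithmeticFunction.moebius n : ℤ) : ℂ)) k =
      ((∑' d : ℕ, (ArithmeticFunction.moebius d : ℝ) / (d : ℝ) ^ k : ℝ) : ℂ) := by
    rw [LSeries, Complex.ofReal_tsum]
    refine tsum_congr fun d => ?_
    rw [LSeries.term_def₀ (by simp)]
    push_cast
    rw [Complex.cpow_neg, Complex.cpow_natCast, div_eq_mul_inv]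
  rw [hL] at h
  exact_mod_cast h

theorem moebius_two_mul (m : ℕ) :
    ArithmeticFunction.moebius (2 * m) = if 2 ∣ m then 0 else -ArithmeticFunction.moebius m := by
  split_ifs with h
  · obtain ⟨c, rfl⟩ := h
    apply ArithmeticFunction.moebius_eq_zero_of_not_squarefree
    intro hsq
    have := hsq 2 ⟨c, by ring⟩
    simp at this
  · have hc : Nat.Coprime 2 m := (Nat.prime_two.coprime_iff_not_dvd).2 h
    rw [ArithmeticFunction.isMultiplicative_moebius.map_mul_of_coprime hc,
      ArithmeticFunction.moebius_apply_prime Nat.prime_two]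
    ring

theorem tsum_moebius_even {k : ℕ} (hk : 2 ≤ k) :
    (2 ^ k - 1) *
        ∑' d : ℕ, (if 2 ∣ d then (ArithmeticFunction.moebius d : ℝ) / (d : ℝ) ^ k else 0) =
      -∑' d : ℕ, (ArithmeticFunction.moebius d : ℝ) / (d : ℝ) ^ k := by
  set a : ℕ → ℝ := fun d => (ArithmeticFunction.moebius d : ℝ) / (d : ℝ) ^ k with ha
  have hs : Summable a := summable_moebius_div hk
  have hodd (m : ℕ) : ¬ 2 ∣ 2 * m + 1 := by omega
  have hse : Summable fun m => a (2 * m) := hs.comp_injective fun x y h => by simpa using h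
  have hso : Summable fun m => a (2 * m + 1) := hs.comp_injective fun x y h => by simpa using h
  have hsplit := tsum_even_add_odd hse hso
  have heven : ∑' d, (if 2 ∣ d then a d else 0) = ∑' m, a (2 * m) := by
    rw [← tsum_even_add_odd (f := fun d => if 2 ∣ d then a d else 0) (by simpa using hse)
      (by simp [hodd])]
    simp [hodd]
  have hodd_sum : ∑' d, (if 2 ∣ d then 0 else a d) = ∑' m, a (2 * m + 1) := by
    rw [← tsum_even_add_odd (f := fun d => if 2 ∣ d then 0 else a d)
      (by simp) (by simpa [hodd] using hso)]
    simp [hodd]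
  have hrel (m : ℕ) : 2 ^ k * a (2 * m) = -(if 2 ∣ m then 0 else a m) := by
    simp only [ha, moebius_two_mul]
    push_cast
    split_ifs
    · simp
    · rw [mul_pow]
      field_simp
  have h2 : 2 ^ k * ∑' m, a (2 * m) = -∑' m, a (2 * m + 1) := by
    rw [← hodd_sum, ← tsum_mul_left, ← tsum_neg]
    exact tsum_congr hrel
  rw [heven, ← hsplit, sub_mul, h2]
  ring

/-- Truncating the Möbius expansion of the indicator of `g = 1`. -/
theorem abs_indicator_sub_sum_moebius_le {g T : ℕ} (hT : T ≠ 0) :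
    |(if g = 1 then 1 else 0 : ℝ) -
      ∑ d ∈ Finset.Icc 1 T, if d ∣ g then (ArithmeticFunction.moebius d : ℝ) else 0| ≤
      (g : ℝ) ^ 2 / T ^ 2 + if g = 0 then (T : ℝ) else 0 := by
  have hT' : (0 : ℝ) < T := by exact_mod_cast Nat.pos_of_ne_zero hT
  by_cases h0 : g = 0
  · subst h0
    simp only [zero_ne_one, if_false, dvd_zero, if_true, zero_sub, abs_neg]
    refine (Finset.abs_sum_le_sum_abs _ _).trans ?_
    refine (Finset.sum_le_card_nsmul _ _ 1 fun d _ => abs_moebius_real_le_one d).trans ?_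
    simp
  · rw [if_neg h0, add_zero]
    have h1 : (if g = 1 then 1 else 0 : ℝ) =
        ∑ d ∈ g.divisors, (ArithmeticFunction.moebius d : ℝ) := by
      have h := congrArg (fun F : ArithmeticFunction ℤ => F g)
        ArithmeticFunction.moebius_mul_coe_zeta
      simp only [ArithmeticFunction.coe_mul_zeta_apply, ArithmeticFunction.one_apply] at h
      exact_mod_cast h.symm
    have h2 : ∑ d ∈ Finset.Icc 1 T, (if d ∣ g then (ArithmeticFunction.moebius d : ℝ) else 0) =
        ∑ d ∈ g.divisors.filter (· ≤ T), (ArithmeticFunction.moebius d : ℝ) := by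
      rw [← Finset.sum_filter]
      refine Finset.sum_congr ?_ fun _ _ => rfl
      ext d
      simp only [Finset.mem_filter, Finset.mem_Icc, Nat.mem_divisors]
      constructor
      · rintro ⟨⟨_, h⟩, h'⟩
        exact ⟨⟨h', h0⟩, h⟩
      · rintro ⟨⟨h', _⟩, h⟩
        exact ⟨⟨Nat.pos_of_dvd_of_pos h' (Nat.pos_of_ne_zero h0), h⟩, h'⟩
    rw [h1, h2, ← Finset.sum_filter_add_sum_filter_not g.divisors (· ≤ T), add_sub_cancel_left]
    refine (Finset.abs_sum_le_sum_abs _ _).trans ?_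
    refine (Finset.sum_le_card_nsmul _ _ 1 fun d _ => abs_moebius_real_le_one d).trans ?_
    have hcard : (g.divisors.filter fun d => ¬ d ≤ T).card ≤ g / T := by
      have : (Finset.Icc 1 (g / T)).card = g / T := by simp
      rw [← this]
      refine Finset.card_le_card_of_injOn (fun d => g / d) ?_ ?_
      · intro d hd
        simp only [Finset.coe_filter, Nat.mem_divisors, Set.mem_ofPred_eq] at hd
        simp only [Finset.coe_Icc, Set.mem_Icc]
        exact ⟨Nat.div_pos (Nat.le_of_dvd (Nat.pos_of_ne_zero h0) hd.1.1) (by omega),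
          Nat.div_le_div_left (by omega) (Nat.pos_of_ne_zero hT)⟩
      · intro d hd e he hde
        simp only [Finset.coe_filter, Nat.mem_divisors, Set.mem_ofPred_eq] at hd he
        have h3 := Nat.div_mul_cancel hd.1.1
        have h4 := Nat.div_mul_cancel he.1.1
        simp only at hde
        rw [hde] at h3
        exact Nat.eq_of_mul_eq_mul_left
          (Nat.div_pos (Nat.le_of_dvd (Nat.pos_of_ne_zero h0) he.1.1) (by omega)) (h3.trans h4.symm)
    have h5 : ((g / T : ℕ) : ℝ) ≤ g / T := Nat.cast_div_le
    rw [nsmul_one, ← div_pow]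
    calc (((g.divisors.filter fun d => ¬ d ≤ T).card : ℕ) : ℝ) ≤ ((g / T : ℕ) : ℝ) := by
          exact_mod_cast hcard
      _ ≤ ((g / T : ℕ) : ℝ) ^ 2 := by exact_mod_cast Nat.le_self_pow two_ne_zero _
      _ ≤ _ := by gcongr

/-- The greatest common divisor of the coordinates, as a natural number. -/
def vecGcd {k : ℕ} (z : Fin k → ℤ) : ℕ := (Finset.univ.gcd z).natAbs

theorem dvd_vecGcd {k d : ℕ} {z : Fin k → ℤ} : d ∣ vecGcd z ↔ ∀ i, (d : ℤ) ∣ z i := by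
  rw [vecGcd, ← Int.natCast_dvd, Finset.dvd_gcd_iff]
  simp

theorem vecGcd_eq_one {k : ℕ} {z : Fin k → ℤ} : vecGcd z = 1 ↔ Finset.univ.gcd z = 1 := by
  have h : 0 ≤ Finset.univ.gcd z :=
    Int.nonneg_of_normalize_eq_self Finset.normalize_gcd
  rw [vecGcd]
  omega

theorem vecGcd_sq_le {k : ℕ} (z : Fin k → ℤ) : (vecGcd z : ℝ) ^ 2 ≤ ∑ i, (z i : ℝ) ^ 2 := by
  by_cases h : ∀ i, z i = 0
  · have : vecGcd z = 0 := by
      rw [← zero_dvd_iff, dvd_vecGcd]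
      simp [h]
    rw [this]
    simp
    positivity
  · push Not at h
    obtain ⟨i, hi⟩ := h
    have h1 : vecGcd z ≤ (z i).natAbs := by
      refine Nat.le_of_dvd (Int.natAbs_pos.2 hi) ?_
      rw [← Int.natCast_dvd]
      exact dvd_vecGcd.1 dvd_rfl i
    have h2 : (vecGcd z : ℝ) ^ 2 ≤ (z i : ℝ) ^ 2 := by
      rw [← sq_abs (z i : ℝ)]
      have : ((z i).natAbs : ℝ) = |(z i : ℝ)| := by rw [Nat.cast_natAbs, Int.cast_abs]
      rw [← this]
      gcongr
    exact h2.trans (Finset.single_le_sum (f := fun i => (z i : ℝ) ^ 2)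
      (fun _ _ => sq_nonneg _) (Finset.mem_univ i))

/-- The number of visible words of length `n`. -/
noncomputable def visibleCount (k n : ℕ) : ℕ :=
  ((wordSphere k n).filter fun f => Finset.univ.gcd (fgAb k f) = 1).card

theorem abs_visibleCount_sub_le {k T : ℕ} (hT : T ≠ 0) (n d : ℕ) :
    |(visibleCount k n : ℝ) -
      ∑ d ∈ Finset.Icc 1 T, (ArithmeticFunction.moebius d : ℝ) * divCount k n d| ≤
      sphereSum n (fun z : Fin k → ℤ => ∑ i, (z i : ℝ) ^ 2) / T ^ 2 + T * divCount k n d := by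
  have hv : (visibleCount k n : ℝ) =
      ∑ f ∈ wordSphere k n, if vecGcd (fgAb k f) = 1 then 1 else 0 := by
    simp [visibleCount, vecGcd_eq_one]
  have hd (d : ℕ) : (divCount k n d : ℝ) =
      ∑ f ∈ wordSphere k n, if d ∣ vecGcd (fgAb k f) then 1 else 0 := by
    simp [divCount, dvd_vecGcd]
  have hm : ∑ d ∈ Finset.Icc 1 T, (ArithmeticFunction.moebius d : ℝ) * divCount k n d =
      ∑ f ∈ wordSphere k n, ∑ d ∈ Finset.Icc 1 T,
        if d ∣ vecGcd (fgAb k f) then (ArithmeticFunction.moebius d : ℝ) else 0 := by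
    rw [Finset.sum_comm]
    simp only [hd, Finset.mul_sum, mul_ite, mul_one, mul_zero]
  rw [hv, hm, ← Finset.sum_sub_distrib]
  refine (Finset.abs_sum_le_sum_abs _ _).trans ?_
  rw [hd d, sphereSum, Finset.sum_div, Finset.mul_sum, ← Finset.sum_add_distrib]
  refine Finset.sum_le_sum fun f _ => (abs_indicator_sub_sum_moebius_le hT).trans ?_
  gcongr
  · exact vecGcd_sq_le _
  · rw [mul_ite, mul_one, mul_zero]
    split_ifs with h1 h2
    · exact le_rfl
    · simp [h1] at h2
    · positivity
    · exact le_rfl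

/-- The range of divisors used at length `n + 1`: roughly `(n + 1) ^ (2 / 3)`. -/
noncomputable def cutoff (n : ℕ) : ℕ := ⌊(((n : ℝ) + 1) ^ (1 / 3 : ℝ)) ^ 2⌋₊

theorem one_le_cbrt (n : ℕ) : 1 ≤ ((n : ℝ) + 1) ^ (1 / 3 : ℝ) :=
  Real.one_le_rpow (by simp) (by norm_num)

theorem cbrt_pow_three (n : ℕ) : (((n : ℝ) + 1) ^ (1 / 3 : ℝ)) ^ 3 = n + 1 := by
  rw [← Real.rpow_natCast, ← Real.rpow_mul (by positivity)]
  norm_num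

theorem cutoff_le (n : ℕ) : (cutoff n : ℝ) ≤ (((n : ℝ) + 1) ^ (1 / 3 : ℝ)) ^ 2 :=
  Nat.floor_le (by positivity)

theorem le_two_mul_cutoff (n : ℕ) : (((n : ℝ) + 1) ^ (1 / 3 : ℝ)) ^ 2 ≤ 2 * cutoff n := by
  have h1 : (1 : ℝ) ≤ cutoff n := by
    exact_mod_cast Nat.le_floor (by simpa using one_le_pow₀ (n := 2) (one_le_cbrt n))
  have h2 := Nat.lt_floor_add_one ((((n : ℝ) + 1) ^ (1 / 3 : ℝ)) ^ 2)
  rw [← cutoff] at h2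
  linarith

theorem cutoff_ne_zero (n : ℕ) : cutoff n ≠ 0 := by
  intro h
  have h1 := le_two_mul_cutoff n
  have h2 := one_le_pow₀ (n := 2) (one_le_cbrt n)
  rw [h, Nat.cast_zero, mul_zero] at h1
  linarith

theorem tendsto_inv_cbrt :
    Tendsto (fun n : ℕ => (((n : ℝ) + 1) ^ (1 / 3 : ℝ))⁻¹) atTop (nhds 0) := by
  refine Tendsto.inv_tendsto_atTop ((tendsto_rpow_atTop (by norm_num)).comp ?_)
  exact tendsto_atTop_add_const_right _ _ tendsto_natCast_atTop_atTop

theorem tendsto_cutoff : Tendsto cutoff atTop atTop := by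
  have h : Tendsto (fun n : ℕ => (((n : ℝ) + 1) ^ (1 / 3 : ℝ))) atTop atTop :=
    (tendsto_rpow_atTop (by norm_num)).comp
      (tendsto_atTop_add_const_right _ _ tendsto_natCast_atTop_atTop)
  exact tendsto_nat_floor_atTop.comp ((tendsto_pow_atTop two_ne_zero).comp h)

theorem one_div_le_of_le_cutoff {n d : ℕ} (hd : d ≠ 0) (h : d ≤ cutoff n) :
    1 / ((n : ℝ) + 1) ≤ 1 / (d : ℝ) ^ (3 / 2 : ℝ) := by
  have hd' : (0 : ℝ) < d := by exact_mod_cast Nat.pos_of_ne_zero hd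
  have h0 := one_le_cbrt n
  gcongr
  rw [← cbrt_pow_three n]
  have h1 : (d : ℝ) ≤ (((n : ℝ) + 1) ^ (1 / 3 : ℝ)) ^ 2 :=
    (by exact_mod_cast h : (d : ℝ) ≤ cutoff n).trans (cutoff_le n)
  refine (Real.rpow_le_rpow hd'.le h1 (by norm_num)).trans_eq ?_
  rw [← Real.rpow_natCast, ← Real.rpow_natCast, ← Real.rpow_mul (by positivity)]
  norm_num

theorem one_div_pow_le_rpow {k d : ℕ} (hk : 2 ≤ k) (hd : d ≠ 0) :
    1 / (d : ℝ) ^ k ≤ 1 / (d : ℝ) ^ (3 / 2 : ℝ) := by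
  have hd' : (1 : ℝ) ≤ d := by exact_mod_cast Nat.one_le_iff_ne_zero.2 hd
  gcongr
  rw [← Real.rpow_natCast]
  refine Real.rpow_le_rpow_of_exponent_le hd' ?_
  have : (2 : ℝ) ≤ k := by exact_mod_cast hk
  linarith

theorem card_wordSphere_pos {k : ℕ} (hk : 1 ≤ k) (n : ℕ) :
    (0 : ℝ) < (wordSphere k (n + 1)).card := by
  have : (1 : ℝ) ≤ k := by exact_mod_cast hk
  exact (pow_pos (by linarith) _).trans_le (pow_le_card_wordSphere hk n)

/-- The proportion of words of length `n + 1` that are visible is approximated by a truncated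
Möbius sum of the divisibility proportions. -/
theorem tendsto_visibleCount_sub {k : ℕ} (hk : 2 ≤ k) :
    Tendsto (fun n : ℕ => (visibleCount k (n + 1) : ℝ) / (wordSphere k (n + 1)).card -
      ∑ d ∈ Finset.Icc 1 (cutoff n), (ArithmeticFunction.moebius d : ℝ) *
        ((divCount k (n + 1) d : ℝ) / (wordSphere k (n + 1)).card)) atTop (nhds 0) := by
  obtain ⟨C, hC, hdiv⟩ := exists_divCount_le hk
  have hlim : Tendsto (fun n : ℕ => (4 * (2 * (k : ℝ)) ^ 2 + 2 * C) *
      (((n : ℝ) + 1) ^ (1 / 3 : ℝ))⁻¹) atTop (nhds 0) := by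
    simpa using tendsto_inv_cbrt.const_mul (4 * (2 * (k : ℝ)) ^ 2 + 2 * C)
  refine squeeze_zero_norm (fun n => ?_) hlim
  set x : ℝ := ((n : ℝ) + 1) ^ (1 / 3 : ℝ) with hx
  have hx1 : 1 ≤ x := one_le_cbrt n
  have hx3 : x ^ 3 = n + 1 := cbrt_pow_three n
  set T := cutoff n with hT
  have hT0 : T ≠ 0 := cutoff_ne_zero n
  have hTpos : (0 : ℝ) < T := by exact_mod_cast Nat.pos_of_ne_zero hT0
  have hTle : (T : ℝ) ≤ x ^ 2 := cutoff_le n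
  have hTge : x ^ 2 ≤ 2 * T := le_two_mul_cutoff n
  set S : ℝ := ((wordSphere k (n + 1)).card : ℝ) with hS
  have hSpos : 0 < S := card_wordSphere_pos (by omega) n
  have hmain := abs_visibleCount_sub_le (k := k) hT0 (n + 1) (n + 1)
  have hsq : sphereSum (n + 1) (fun z : Fin k → ℤ => ∑ i, (z i : ℝ) ^ 2) ≤
      (2 * k) ^ 2 * (n + 1) * S := by
    refine (sphereSum_sum_sq_le hk (n + 1)).trans ?_
    push_cast
    gcongr
    exact pow_le_card_wordSphere (by omega) n
  have hdiv' := hdiv n (n + 1) (by omega)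
  rw [← hS] at hdiv'
  have hdist : (visibleCount k (n + 1) : ℝ) / S -
      ∑ d ∈ Finset.Icc 1 T, (ArithmeticFunction.moebius d : ℝ) *
        ((divCount k (n + 1) d : ℝ) / S) =
      ((visibleCount k (n + 1) : ℝ) -
        ∑ d ∈ Finset.Icc 1 T, (ArithmeticFunction.moebius d : ℝ) * divCount k (n + 1) d) / S := by
    rw [sub_div, Finset.sum_div]
    simp only [mul_div_assoc]
  rw [hdist, Real.norm_eq_abs, abs_div, abs_of_pos hSpos]
  have hfirst : ((n : ℝ) + 1) / T ^ 2 ≤ 4 * x⁻¹ := by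
    rw [← hx3, div_le_iff₀ (by positivity)]
    have : x ^ 4 ≤ 4 * (T : ℝ) ^ 2 := by nlinarith [sq_nonneg x]
    calc x ^ 3 = x⁻¹ * x ^ 4 := by field_simp
      _ ≤ x⁻¹ * (4 * (T : ℝ) ^ 2) := by gcongr
      _ = _ := by ring
  have hsecond : (T : ℝ) * (1 / ((n + 1 : ℕ) : ℝ) ^ 2 + 1 / ((n : ℝ) + 1)) ≤ 2 * x⁻¹ := by
    push_cast
    rw [← hx3]
    have h1 : 1 / (x ^ 3) ^ 2 ≤ 1 / x ^ 3 := by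
      gcongr
      exact le_self_pow₀ (one_le_pow₀ hx1) two_ne_zero
    calc (T : ℝ) * (1 / (x ^ 3) ^ 2 + 1 / x ^ 3) ≤ x ^ 2 * (1 / x ^ 3 + 1 / x ^ 3) := by gcongr
      _ = 2 * x⁻¹ := by field_simp; ring
  calc _ ≤ (sphereSum (n + 1) (fun z : Fin k → ℤ => ∑ i, (z i : ℝ) ^ 2) / T ^ 2 +
        T * divCount k (n + 1) (n + 1)) / S := by gcongr
    _ ≤ ((2 * k) ^ 2 * (n + 1) * S / T ^ 2 + T * divCount k (n + 1) (n + 1)) / S := by gcongr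
    _ = (2 * k) ^ 2 * ((n + 1) / T ^ 2) + T * (divCount k (n + 1) (n + 1) / S) := by field_simp
    _ ≤ (2 * k) ^ 2 * ((n + 1) / T ^ 2) +
        T * (C * (1 / ((n + 1 : ℕ) : ℝ) ^ 2 + 1 / ((n : ℝ) + 1))) := by gcongr
    _ = (2 * k) ^ 2 * ((n + 1) / T ^ 2) +
        C * (T * (1 / ((n + 1 : ℕ) : ℝ) ^ 2 + 1 / ((n : ℝ) + 1))) := by ring
    _ ≤ (2 * k) ^ 2 * (4 * x⁻¹) + C * (2 * x⁻¹) := by gcongr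
    _ = _ := by ring

theorem abs_one_add_ite_le (n d : ℕ) :
    |(1 + if 2 ∣ d then (-1) ^ (n + 1) else 0 : ℝ)| ≤ 2 := by
  split_ifs
  · rcases neg_one_pow_eq_or ℝ (n + 1) with h | h <;> rw [h] <;> norm_num
  · norm_num

/-- The truncated Möbius sum of the divisibility proportions converges, by dominated
convergence. -/
theorem tendsto_sum_moebius_divCount {k : ℕ} (hk : 2 ≤ k) :
    Tendsto (fun n : ℕ => ∑ d ∈ Finset.Icc 1 (cutoff n), (ArithmeticFunction.moebius d : ℝ) *
        ((divCount k (n + 1) d : ℝ) / (wordSphere k (n + 1)).card) -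
      ∑' d : ℕ, (ArithmeticFunction.moebius d : ℝ) *
        ((1 + if 2 ∣ d then (-1) ^ (n + 1) else 0) / (d : ℝ) ^ k)) atTop (nhds 0) := by
  obtain ⟨C, hC, hdiv⟩ := exists_divCount_le hk
  have hsb : Summable fun d : ℕ => (2 * C + 2) * (1 / (d : ℝ) ^ (3 / 2 : ℝ)) :=
    (Real.summable_one_div_nat_rpow.2 (by norm_num)).mul_left _
  have hlimbound (n d : ℕ) : |(ArithmeticFunction.moebius d : ℝ) *
      ((1 + if 2 ∣ d then (-1) ^ (n + 1) else 0) / (d : ℝ) ^ k)| ≤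
        2 * (1 / (d : ℝ) ^ (3 / 2 : ℝ)) := by
    rcases eq_or_ne d 0 with rfl | hd
    · simp
    rw [abs_mul, abs_div, abs_of_nonneg (by positivity : (0 : ℝ) ≤ (d : ℝ) ^ k)]
    calc _ ≤ 1 * (2 / (d : ℝ) ^ k) := by
          gcongr
          · exact abs_moebius_real_le_one d
          · exact abs_one_add_ite_le n d
      _ = 2 * (1 / (d : ℝ) ^ k) := by ring
      _ ≤ _ := by
          gcongr ?_ * ?_
          exact one_div_pow_le_rpow hk hd
  have hsl (n : ℕ) : Summable fun d : ℕ => (ArithmeticFunction.moebius d : ℝ) *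
      ((1 + if 2 ∣ d then (-1) ^ (n + 1) else 0) / (d : ℝ) ^ k) :=
    Summable.of_norm_bounded ((Real.summable_one_div_nat_rpow.2 (by norm_num)).mul_left 2)
      (hlimbound n)
  have hterm (n : ℕ) : ∑ d ∈ Finset.Icc 1 (cutoff n), (ArithmeticFunction.moebius d : ℝ) *
        ((divCount k (n + 1) d : ℝ) / (wordSphere k (n + 1)).card) -
      ∑' d : ℕ, (ArithmeticFunction.moebius d : ℝ) *
        ((1 + if 2 ∣ d then (-1) ^ (n + 1) else 0) / (d : ℝ) ^ k) =
      ∑' d : ℕ, ((if d ∈ Finset.Icc 1 (cutoff n) then (ArithmeticFunction.moebius d : ℝ) *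
        ((divCount k (n + 1) d : ℝ) / (wordSphere k (n + 1)).card) else 0) -
        (ArithmeticFunction.moebius d : ℝ) *
        ((1 + if 2 ∣ d then (-1) ^ (n + 1) else 0) / (d : ℝ) ^ k)) := by
    rw [Summable.tsum_sub _ (hsl n)]
    · congr 1
      rw [tsum_eq_sum (s := Finset.Icc 1 (cutoff n)) fun d hd => if_neg hd]
      exact Finset.sum_congr rfl fun d hd => (if_pos hd).symm
    · exact summable_of_ne_finset_zero (s := Finset.Icc 1 (cutoff n)) fun d hd => if_neg hd
  simp only [hterm]
  have hzero : nhds (0 : ℝ) = nhds (∑' _ : ℕ, 0) := by rw [tsum_zero]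
  rw [hzero]
  refine tendsto_tsum_of_dominated_convergence hsb (fun d => ?_) (.of_forall fun n d => ?_)
  · rcases eq_or_ne d 0 with rfl | hd
    · simp
    have h := (tendsto_divCount hk hd).const_mul (ArithmeticFunction.moebius d : ℝ)
    rw [mul_zero] at h
    refine h.congr' ?_
    filter_upwards [tendsto_cutoff.eventually_ge_atTop d] with n hn
    rw [if_pos (Finset.mem_Icc.2 ⟨Nat.one_le_iff_ne_zero.2 hd, hn⟩), mul_sub]
  · refine (norm_sub_le _ _).trans ?_
    rw [add_mul]
    refine add_le_add ?_ (hlimbound n d)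
    split_ifs with h
    · rw [Finset.mem_Icc] at h
      have hd : d ≠ 0 := by omega
      rw [Real.norm_eq_abs, abs_mul, abs_of_nonneg (by positivity :
        (0 : ℝ) ≤ (divCount k (n + 1) d : ℝ) / (wordSphere k (n + 1)).card)]
      calc _ ≤ 1 * (C * (1 / (d : ℝ) ^ 2 + 1 / (n + 1))) := by
            gcongr
            · exact abs_moebius_real_le_one d
            · exact hdiv n d hd
        _ ≤ 1 * (C * (1 / (d : ℝ) ^ (3 / 2 : ℝ) + 1 / (d : ℝ) ^ (3 / 2 : ℝ))) := by
            gcongr ?_ * (?_ * (?_ + ?_))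
            · exact one_div_pow_le_rpow le_rfl hd
            · exact one_div_le_of_le_cutoff hd h.2
        _ = _ := by ring
    · simp
      positivity

/-- The proportion of visible words of length `n + 1`, up to `o(1)`. -/
theorem tendsto_visible_proportion {k : ℕ} (hk : 2 ≤ k) :
    Tendsto (fun n : ℕ => (visibleCount k (n + 1) : ℝ) / (wordSphere k (n + 1)).card -
      (2 ^ k - 1 - (-1) ^ (n + 1)) / ((2 ^ k - 1) * zetaR k)) atTop (nhds 0) := by
  have h := (tendsto_visibleCount_sub hk).add (tendsto_sum_moebius_divCount hk)
  rw [add_zero] at h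
  refine h.congr fun n => ?_
  rw [sub_add_sub_cancel]
  congr 1
  have hs := summable_moebius_div hk
  have hse : Summable fun d : ℕ =>
      (if 2 ∣ d then (ArithmeticFunction.moebius d : ℝ) / (d : ℝ) ^ k else 0) := by
    refine hs.norm.of_norm_bounded fun d => ?_
    split_ifs
    · exact le_rfl
    · rw [norm_zero]
      positivity
  have hsplit : ∑' d : ℕ, (ArithmeticFunction.moebius d : ℝ) *
        ((1 + if 2 ∣ d then (-1) ^ (n + 1) else 0) / (d : ℝ) ^ k) =
      ∑' d : ℕ, (ArithmeticFunction.moebius d : ℝ) / (d : ℝ) ^ k + (-1) ^ (n + 1) *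
        ∑' d : ℕ, (if 2 ∣ d then (ArithmeticFunction.moebius d : ℝ) / (d : ℝ) ^ k else 0) := by
    rw [← tsum_mul_left, ← hs.tsum_add (hse.mul_left _)]
    refine tsum_congr fun d => ?_
    split_ifs <;> ring
  have hz := zetaR_mul_tsum_moebius hk
  have he := tsum_moebius_even hk
  have hz0 : zetaR k ≠ 0 := left_ne_zero_of_mul_eq_one hz
  have hp : (2 : ℝ) ^ k - 1 ≠ 0 := by
    have : (1 : ℝ) < 2 ^ k := one_lt_pow₀ (by norm_num) (by omega)
    linarith
  rw [hsplit, eq_div_iff (mul_ne_zero hp hz0)]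
  linear_combination (2 ^ k - 1 - (-1) ^ (n + 1)) * hz + (-1) ^ (n + 1) * zetaR k * he

theorem ncard_wordSphere (k n : ℕ) :
    {f : FreeGroup (Fin k) | f.toWord.length = n}.ncard = (wordSphere k n).card := by
  rw [← Set.ncard_coe_finset]
  congr 1
  ext f
  simp [mem_wordSphere]

theorem ncard_visible (k n : ℕ) :
    {f : FreeGroup (Fin k) | Finset.univ.gcd (fgAb k f) = 1 ∧ f.toWord.length = n}.ncard =
      visibleCount k n := by
  rw [visibleCount, ← Set.ncard_coe_finset]
  congr 1
  ext f
  simp [mem_wordSphere, and_comm]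

/-- Let `k ≥ 2`, `F_k` the free group of rank `k` with reduced-word length `|·|`
(`|f| = f.toWord.length`), and `V_1` the set of visible elements of `F_k`. Then
`#{f ∈ V_1 : |f| = 2m}/#{f ∈ F_k : |f| = 2m} → (2^k − 2)/((2^k − 1)ζ(k))` and
`#{f ∈ V_1 : |f| = 2m−1}/#{f ∈ F_k : |f| = 2m−1} → 2^k/((2^k − 1)ζ(k))` as `m → ∞`. -/
theorem stmt_14 (k : ℕ) (hk : 2 ≤ k) :
    Tendsto (fun m : ℕ =>
        ({f : FreeGroup (Fin k) | Finset.univ.gcd (fgAb k f) = 1 ∧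
            f.toWord.length = 2 * m}.ncard : ℝ) /
          ({f : FreeGroup (Fin k) | f.toWord.length = 2 * m}.ncard : ℝ))
      atTop (nhds ((2 ^ k - 2 : ℝ) / ((2 ^ k - 1) * zetaR k))) ∧
    Tendsto (fun m : ℕ =>
        ({f : FreeGroup (Fin k) | Finset.univ.gcd (fgAb k f) = 1 ∧
            f.toWord.length = 2 * m + 1}.ncard : ℝ) /
          ({f : FreeGroup (Fin k) | f.toWord.length = 2 * m + 1}.ncard : ℝ))
      atTop (nhds ((2 ^ k : ℝ) / ((2 ^ k - 1) * zetaR k))) := by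
  have h := tendsto_visible_proportion hk
  simp only [ncard_wordSphere, ncard_visible]
  constructor
  · rw [← tendsto_add_atTop_iff_nat 1]
    have h1 : Tendsto (fun m : ℕ => 2 * m + 1) atTop atTop :=
      tendsto_atTop_mono (fun m => by simp only [id]; omega) tendsto_id
    rw [← tendsto_sub_nhds_zero_iff]
    refine (h.comp h1).congr fun m => ?_
    simp only [Function.comp_apply]
    rw [show 2 * m + 1 + 1 = 2 * (m + 1) by ring, pow_mul]
    norm_num [sub_sub]
  · have h1 : Tendsto (fun m : ℕ => 2 * m) atTop atTop :=
      tendsto_atTop_mono (fun m => by simp only [id]; omega) tendsto_id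
    rw [← tendsto_sub_nhds_zero_iff]
    refine (h.comp h1).congr fun m => ?_
    simp only [Function.comp_apply]
    rw [pow_succ, pow_mul]
    norm_num
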